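/- 2VPA capture EMSO: a set L of nested words over a 2-stack call-return alphabet is recognized by a 2-stack visibly pushdown automaton if and only if L is definable by an existential monadic second-order sentence ∃X₁…∃X_n φ (φ first-order) over the signature with unary label predicates λ_a (a ∈ Σ), the successor relation ⋖, and the matching relation μ. -/

import Mathlib

/-- The *kind* of a letter in a `K`-stack call-return alphabet: a call of some
stack `s`, a return of some stack `s`, or an internal action. -/
inductive CRKind (K : ℕ) where
  | call (s : Fin K)
  | ret (s : Fin K)
  | int

/-- A `K`-stack call-return alphabet over the letters `A`: every letter is
(exclusively) a call of one stack, a return of one stack, or internal.  This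
encodes the pairwise disjointness of the collection
`⟨{(Σ_c^s, Σ_r^s)}_{s∈[K]}, Σ_int⟩` together with `Σ` being their union. -/
structure CRAlphabet (K : ℕ) (A : Type) where
  kind : A → CRKind K

namespace CRAlphabet

variable {K : ℕ} {A : Type}

def callSet (h : CRAlphabet K A) (s : Fin K) : Set A := {a | h.kind a = .call s}
def retSet (h : CRAlphabet K A) (s : Fin K) : Set A := {a | h.kind a = .ret s}
def intSet (h : CRAlphabet K A) : Set A := {a | h.kind a = .int}

end CRAlphabet

/-- `s`-well-formed strings: generated by the grammar
`A ::= aAb | AA | ε | c` with `a ∈ c`, `b ∈ r`, `c ∉ c ∪ r`. -/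
inductive SWellFormed {A : Type} (c r : Set A) : List A → Prop where
  | nil : SWellFormed c r []
  | single {x : A} : x ∉ c → x ∉ r → SWellFormed c r [x]
  | wrap {a b : A} {u : List A} : a ∈ c → b ∈ r → SWellFormed c r u →
      SWellFormed c r (a :: u ++ [b])
  | concat {u v : List A} : SWellFormed c r u → SWellFormed c r v →
      SWellFormed c r (u ++ v)

/-- The matching relation `μ^s` of the nested word determined by the string
`w` (positions `0`-based): `(i,j) ∈ μ^s` iff `i < j`, `λ(i) ∈ Σ_c^s`,
`λ(j) ∈ Σ_r^s` and `λ(i+1) … λ(j-1)` is `s`-well formed. -/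
def Matched {K : ℕ} {A : Type} (h : CRAlphabet K A) (w : List A) (s : Fin K)
    (i j : ℕ) : Prop :=
  i < j ∧ j < w.length ∧
  (∃ a, w[i]? = some a ∧ a ∈ h.callSet s) ∧
  (∃ b, w[j]? = some b ∧ b ∈ h.retSet s) ∧
  SWellFormed (h.callSet s) (h.retSet s) ((w.take j).drop (i + 1))

/-- The full matching relation `μ = ⋃_s μ^s`. -/
def MuAny {K : ℕ} {A : Type} (h : CRAlphabet K A) (w : List A) (i j : ℕ) : Prop :=
  ∃ s, Matched h w s i j

/-- A multi-stack visibly pushdown automaton over a `K`-stack call-return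
alphabet, with states `Q` and stack alphabet `Γ` (the bottom symbol `⊥` is
represented implicitly: a stack contents is a list over `Γ`, the empty list
standing for the stack containing only `⊥`; in pop transitions the stack
symbol `none` stands for `⊥`). -/
structure MVPA (K : ℕ) (A Q Γ : Type) where
  pushT : Q → A → Γ → Q → Prop
  popT : Q → A → Option Γ → Q → Prop
  intT : Q → A → Q → Prop
  qI : Set Q
  qF : Set Q

/-- One step of the MVPA `M` reading letter `a`, from configuration `c` to
configuration `c'` (a configuration is a state together with one stack
contents per stack). -/
def vStep {K : ℕ} {A Q Γ : Type} (h : CRAlphabet K A) (M : MVPA K A Q Γ)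
    (a : A) (c c' : Q × (Fin K → List Γ)) : Prop :=
  (∃ s, h.kind a = .call s ∧ ∃ g, M.pushT c.1 a g c'.1 ∧
     c'.2 s = g :: c.2 s ∧ ∀ t, t ≠ s → c'.2 t = c.2 t) ∨
  (∃ s, h.kind a = .ret s ∧ (∀ t, t ≠ s → c'.2 t = c.2 t) ∧
     ((∃ g, M.popT c.1 a (some g) c'.1 ∧ c.2 s = g :: c'.2 s) ∨
      (M.popT c.1 a none c'.1 ∧ c.2 s = [] ∧ c'.2 s = []))) ∨
  (h.kind a = .int ∧ M.intT c.1 a c'.1 ∧ c'.2 = c.2)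

/-- The MVPA `M` accepts the string `w`: some run starting in an initial state
with all stacks empty and ending in a final state. -/
def vAccepts {K : ℕ} {A Q Γ : Type} (h : CRAlphabet K A) (M : MVPA K A Q Γ)
    (w : List A) : Prop :=
  ∃ f : ℕ → Q × (Fin K → List Γ),
    (f 0).1 ∈ M.qI ∧ (∀ s, (f 0).2 s = []) ∧
    (∀ i a, w[i]? = some a → vStep h M a (f i) (f (i + 1))) ∧
    (f w.length).1 ∈ M.qF

/-- The language of the MVPA `M` (nonempty strings, identified with their
nested words). -/
def vLang {K : ℕ} {A Q Γ : Type} (h : CRAlphabet K A) (M : MVPA K A Q Γ) :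
    Set (List A) :=
  {w | w ≠ [] ∧ vAccepts h M w}

/-- MSO formulas over the signature `τ_Σ̃ = {λ_a | a ∈ Σ} ∪ {⋖, μ}` of nested
words (first-order variables and second-order variables are indexed by `ℕ`). -/
inductive MSO (A : Type) where
  | lab (a : A) (x : ℕ)
  | succ (x y : ℕ)
  | mu (x y : ℕ)
  | eq (x y : ℕ)
  | mem (x : ℕ) (X : ℕ)
  | not (φ : MSO A)
  | or (φ ψ : MSO A)
  | ex1 (x : ℕ) (φ : MSO A)
  | ex2 (X : ℕ) (φ : MSO A)

/-- Satisfaction of an MSO formula in the nested word of `w`, under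
first-order valuation `ν` and second-order valuation `μv`. -/
def Sat {K : ℕ} {A : Type} (h : CRAlphabet K A) (w : List A) :
    MSO A → (ℕ → ℕ) → (ℕ → Set ℕ) → Prop
  | .lab a x, ν, _ => w[(ν x)]? = some a
  | .succ x y, ν, _ => ν y = ν x + 1 ∧ ν y < w.length
  | .mu x y, ν, _ => MuAny h w (ν x) (ν y)
  | .eq x y, ν, _ => ν x = ν y
  | .mem x X, ν, μv => ν x ∈ μv X
  | .not φ, ν, μv => ¬ Sat h w φ ν μv
  | .or φ ψ, ν, μv => Sat h w φ ν μv ∨ Sat h w ψ ν μv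
  | .ex1 x φ, ν, μv => ∃ i < w.length, Sat h w φ (Function.update ν x i) μv
  | .ex2 X φ, ν, μv => ∃ S : Set ℕ, S ⊆ {i | i < w.length} ∧
      Sat h w φ ν (Function.update μv X S)

/-- First-order formulas: no second-order quantification. -/
def FirstOrder {A : Type} : MSO A → Prop
  | .not φ => FirstOrder φ
  | .or φ ψ => FirstOrder φ ∧ FirstOrder ψ
  | .ex1 _ φ => FirstOrder φ
  | .ex2 _ _ => False
  | _ => True

/-- Existential MSO formulas: a block of existential second-order quantifiers
followed by a first-order formula. -/
inductive IsEMSO {A : Type} : MSO A → Prop where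
  | fo {φ} : FirstOrder φ → IsEMSO φ
  | ex {X φ} : IsEMSO φ → IsEMSO (MSO.ex2 X φ)

/-- Semantic sentencehood: satisfaction does not depend on the valuations. -/
def ClosedOn {K : ℕ} {A : Type} (h : CRAlphabet K A) (φ : MSO A) : Prop :=
  ∀ w ν ν' μv μv', Sat h w φ ν μv ↔ Sat h w φ ν' μv'

/-- The set of nested words (nonempty strings) defined by a sentence. -/
def mLang {K : ℕ} {A : Type} (h : CRAlphabet K A) (φ : MSO A) : Set (List A) :=
  {w | w ≠ [] ∧ Sat h w φ (fun _ => 0) (fun _ => ∅)}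


section PendingCalls

variable {K : ℕ} {A : Type} (h : CRAlphabet K A) (w : List A) (s : Fin K)

/-- The positions of the calls of stack `s` that are pending after reading the first `k` letters
of `w`, most recent first. -/
def pend (h : CRAlphabet K A) (w : List A) (s : Fin K) : ℕ → List ℕ
  | 0 => []
  | k + 1 =>
    match w[k]? with
    | none => pend h w s k
    | some a =>
      match h.kind a with
      | .call t => if t = s then k :: pend h w s k else pend h w s k
      | .ret t => if t = s then (pend h w s k).tail else pend h w s k
      | .int => pend h w s k

variable {h w s}

lemma pend_succ_call {k : ℕ} {a : A} (ha : w[k]? = some a) (hk : h.kind a = .call s) :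
    pend h w s (k + 1) = k :: pend h w s k := by
  simp [pend, ha, hk]

lemma pend_succ_ret {k : ℕ} {a : A} (ha : w[k]? = some a) (hk : h.kind a = .ret s) :
    pend h w s (k + 1) = (pend h w s k).tail := by
  simp [pend, ha, hk]

lemma pend_succ_of_ne {k : ℕ} {a : A} (ha : w[k]? = some a) (hc : h.kind a ≠ .call s)
    (hr : h.kind a ≠ .ret s) : pend h w s (k + 1) = pend h w s k := by
  rcases hk : h.kind a with t | t | _
  · have : t ≠ s := by rintro rfl; exact hc hk
    simp [pend, ha, hk, this]
  · have : t ≠ s := by rintro rfl; exact hr hk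
    simp [pend, ha, hk, this]
  · simp [pend, ha, hk]

lemma pend_succ_cases (k : ℕ) :
    pend h w s (k + 1) = pend h w s k ∨
    (pend h w s (k + 1) = k :: pend h w s k ∧ ∃ a, w[k]? = some a ∧ h.kind a = .call s) ∨
    (pend h w s (k + 1) = (pend h w s k).tail ∧ ∃ a, w[k]? = some a ∧ h.kind a = .ret s) := by
  rcases ha : w[k]? with _ | a
  · left; simp [pend, ha]
  · by_cases hc : h.kind a = .call s
    · exact .inr (.inl ⟨pend_succ_call ha hc, a, rfl, hc⟩)
    · by_cases hr : h.kind a = .ret s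
      · exact .inr (.inr ⟨pend_succ_ret ha hr, a, rfl, hr⟩)
      · exact .inl (pend_succ_of_ne ha hc hr)

lemma lt_of_mem_pend {k x : ℕ} (hx : x ∈ pend h w s k) : x < k := by
  induction k with
  | zero => simp [pend] at hx
  | succ k ih =>
    rcases pend_succ_cases (h := h) (w := w) (s := s) k with e | ⟨e, -⟩ | ⟨e, -⟩ <;> rw [e] at hx
    · exact (ih hx).trans (Nat.lt_succ_self k)
    · rcases List.mem_cons.1 hx with rfl | hx
      · exact Nat.lt_succ_self _
      · exact (ih hx).trans (Nat.lt_succ_self k)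
    · exact (ih (List.mem_of_mem_tail hx)).trans (Nat.lt_succ_self k)

lemma pairwise_pend (k : ℕ) : (pend h w s k).Pairwise (· > ·) := by
  induction k with
  | zero => simp [pend]
  | succ k ih =>
    rcases pend_succ_cases (h := h) (w := w) (s := s) k with e | ⟨e, -⟩ | ⟨e, -⟩ <;> rw [e]
    · exact ih
    · exact List.pairwise_cons.2 ⟨fun x hx => lt_of_mem_pend hx, ih⟩
    · exact ih.tail

lemma mem_pend_of_le {j k x : ℕ} (hx : x ∈ pend h w s j) (hxk : x < k) (hkj : k ≤ j) :
    x ∈ pend h w s k := by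
  induction j, hkj using Nat.le_induction with
  | base => exact hx
  | succ j hkj ih =>
    apply ih
    rcases pend_succ_cases (h := h) (w := w) (s := s) j with e | ⟨e, -⟩ | ⟨e, -⟩ <;> rw [e] at hx
    · exact hx
    · rcases List.mem_cons.1 hx with rfl | hx
      · omega
      · exact hx
    · exact List.mem_of_mem_tail hx

lemma SWellFormed.pend_add_length {u : List A}
    (hu : SWellFormed (h.callSet s) (h.retSet s) u) :
    ∀ k, u <+: w.drop k → pend h w s (k + u.length) = pend h w s k := by
  induction hu with
  | nil => simp
  | single hc hr =>
    intro k hk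
    obtain ⟨v, hv⟩ := hk
    have hk := congrArg (·[0]?) hv
    simp only [List.getElem?_drop, List.singleton_append, List.getElem?_cons_zero,
      add_zero] at hk
    exact pend_succ_of_ne hk.symm hc hr
  | @wrap a b u ha hb _ ih =>
    intro k hk
    obtain ⟨v, hv⟩ := hk
    have hka : w[k]? = some a := by
      have := congrArg (·[0]?) hv
      simpa using this.symm
    have hu : w.drop (k + 1) = u ++ ([b] ++ v) := by
      rw [← List.drop_drop, ← hv]; simp
    have hkb : w[k + 1 + u.length]? = some b := by
      rw [← List.getElem?_drop, hu]; simp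
    have h1 := ih (k + 1) ⟨_, hu.symm⟩
    have h2 := pend_succ_ret (s := s) hkb hb
    rw [h1, pend_succ_call hka ha, List.tail_cons] at h2
    rw [← h2]; congr 1; simp; omega
  | @concat u v _ _ ihu ihv =>
    rintro k ⟨x, hx⟩
    have h1 := ihu k ⟨v ++ x, by simpa using hx⟩
    have h2 := ihv (k + u.length) ⟨x, by rw [← List.drop_drop, ← hx]; simp⟩
    rw [← h1, ← h2]; congr 1; simp; omega

private lemma segment_succ {i k : ℕ} {a : A} (hik : i < k) (ha : w[k]? = some a) :
    (w.take (k + 1)).drop (i + 1) = (w.take k).drop (i + 1) ++ [a] := by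
  have hk : k < w.length := (List.getElem?_eq_some_iff.1 ha).1
  rw [List.take_add_one, ha, List.drop_append_of_le_length]
  · rfl
  · simp; omega

private lemma segment_split {i x k : ℕ} {a : A} (hix : i < x) (hxk : x < k)
    (ha : w[x]? = some a) :
    (w.take k).drop (i + 1) =
      (w.take x).drop (i + 1) ++ (a :: (w.take k).drop (x + 1)) := by
  have hx : x < w.length := (List.getElem?_eq_some_iff.1 ha).1
  have e : w.take k = w.take x ++ (a :: (w.take k).drop (x + 1)) := by
    conv_lhs => rw [← List.take_append_drop x (w.take k)]
    rw [List.take_take, min_eq_left hxk.le]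
    congr 1
    rw [List.drop_eq_getElem_cons (by simp; omega)]
    congr 1
    rw [List.getElem_take]
    exact (List.getElem?_eq_some_iff.1 ha).2
  conv_lhs => rw [e]
  rw [List.drop_append_of_le_length (by simp; omega)]

lemma pend_cons {k : ℕ} : ∀ {i : ℕ} {σ : List ℕ}, k ≤ w.length → pend h w s k = i :: σ →
    i < k ∧ (∃ a, w[i]? = some a ∧ h.kind a = .call s) ∧
    SWellFormed (h.callSet s) (h.retSet s) ((w.take k).drop (i + 1)) ∧ σ = pend h w s i := by
  induction k using Nat.strong_induction_on with
  | _ k ih =>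
    intro i σ hk he
    obtain _ | k := k
    · simp [pend] at he
    have hk' : k < w.length := hk
    have ha : w[k]? = some w[k] := List.getElem?_eq_getElem hk'
    by_cases hc : h.kind w[k] = .call s
    · rw [pend_succ_call ha hc] at he
      obtain ⟨rfl, rfl⟩ := List.cons.inj he
      refine ⟨Nat.lt_succ_self _, ⟨_, ha, hc⟩, ?_, rfl⟩
      rw [List.drop_eq_nil_of_le (by simp)]
      exact .nil
    · by_cases hr : h.kind w[k] = .ret s
      · rw [pend_succ_ret ha hr] at he
        rcases hp : pend h w s k with _ | ⟨x, τ⟩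
        · simp [hp] at he
        rw [hp, List.tail_cons] at he
        obtain ⟨hx, ⟨b, hb, hbc⟩, hxs, hxτ⟩ := ih k (Nat.lt_succ_self k) hk'.le hp
        obtain ⟨hi, hic, his, hiσ⟩ := ih x (by omega) (by omega) (hxτ.symm.trans he)
        refine ⟨by omega, hic, ?_, hiσ⟩
        rw [segment_succ (by omega) ha, segment_split hi hx hb, List.append_assoc]
        exact his.concat (.wrap hbc hr hxs)
      · rw [pend_succ_of_ne ha hc hr] at he
        obtain ⟨hi, hic, his, hiσ⟩ := ih k (Nat.lt_succ_self k) hk'.le he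
        refine ⟨by omega, hic, ?_, hiσ⟩
        rw [segment_succ hi ha]
        exact his.concat (.single hc hr)

lemma matched_iff {i j : ℕ} : Matched h w s i j ↔
    (∃ b, w[j]? = some b ∧ h.kind b = .ret s) ∧ (pend h w s j).head? = some i := by
  constructor
  · rintro ⟨hij, hj, ⟨a, ha, hac⟩, hb, hs⟩
    refine ⟨hb, ?_⟩
    have := hs.pend_add_length (w := w) (i + 1) (by
      rw [List.drop_take]; exact List.take_prefix _ _)
    rw [pend_succ_call ha hac] at this
    have e : i + 1 + ((w.take j).drop (i + 1)).length = j := by simp; omega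
    rw [e] at this
    simp [this]
  · rintro ⟨⟨b, hb, hbr⟩, hp⟩
    have hj : j < w.length := (List.getElem?_eq_some_iff.1 hb).1
    rcases hq : pend h w s j with _ | ⟨x, σ⟩
    · simp [hq] at hp
    · obtain rfl : x = i := by simpa [hq] using hp
      obtain ⟨h1, h2, h3, -⟩ := pend_cons hj.le hq
      exact ⟨h1, hj, h2, ⟨b, hb, hbr⟩, h3⟩

namespace Matched

variable {i i' j j' : ℕ} {t : Fin K}

lemma lt (hm : Matched h w s i j) : i < j := hm.1

lemma lt_length (hm : Matched h w s i j) : j < w.length := hm.2.1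

lemma exists_call (hm : Matched h w s i j) : ∃ a, w[i]? = some a ∧ h.kind a = .call s := hm.2.2.1

lemma exists_ret (hm : Matched h w s i j) : ∃ b, w[j]? = some b ∧ h.kind b = .ret s := hm.2.2.2.1

lemma pend_eq (hm : Matched h w s i j) : pend h w s j = i :: pend h w s i := by
  have h1 := (matched_iff.1 hm).2
  rcases hq : pend h w s j with _ | ⟨x, σ⟩
  · simp [hq] at h1
  · obtain rfl : x = i := by simpa [hq] using h1
    rw [(pend_cons hm.lt_length.le hq).2.2.2]

lemma stack_unique_left (hm : Matched h w s i j) (hm' : Matched h w t i j') : s = t := by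
  obtain ⟨a, ha, hs⟩ := hm.exists_call
  obtain ⟨b, hb, ht⟩ := hm'.exists_call
  rw [ha] at hb; cases hb
  rw [hs] at ht; cases ht; rfl

lemma stack_unique_right (hm : Matched h w s i j) (hm' : Matched h w t i' j) : s = t := by
  obtain ⟨a, ha, hs⟩ := hm.exists_ret
  obtain ⟨b, hb, ht⟩ := hm'.exists_ret
  rw [ha] at hb; cases hb
  rw [hs] at ht; cases ht; rfl

lemma ret_ne_call (hm : Matched h w s i j) (hm' : Matched h w t j j') : False := by
  obtain ⟨a, ha, hs⟩ := hm.exists_ret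
  obtain ⟨b, hb, ht⟩ := hm'.exists_call
  rw [ha] at hb; cases hb
  rw [hs] at ht; cases ht

lemma left_unique (hm : Matched h w s i j) (hm' : Matched h w s i' j) : i = i' := by
  have h1 := hm.pend_eq
  rw [hm'.pend_eq] at h1
  exact (List.cons.inj h1).1.symm

lemma not_cross (hm : Matched h w s i j) (hm' : Matched h w s i' j') :
    ¬ (i < i' ∧ i' < j ∧ j < j') := by
  rintro ⟨h1, h2, h3⟩
  have h4 : i' ∈ pend h w s j :=
    mem_pend_of_le (by rw [hm'.pend_eq]; simp) h2 h3.le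
  have h5 := pairwise_pend (h := h) (w := w) (s := s) j
  rw [hm.pend_eq] at h4 h5
  rcases List.mem_cons.1 h4 with h4 | h4
  · omega
  · have := (List.pairwise_cons.1 h5).1 _ h4
    omega

private lemma right_le (hm : Matched h w s i j) (hm' : Matched h w s i j') : j' ≤ j := by
  by_contra! hlt
  obtain ⟨b, hb, hr⟩ := hm.exists_ret
  have h1 : i ∈ pend h w s (j + 1) :=
    mem_pend_of_le (by rw [hm'.pend_eq]; simp) (by have := hm.lt; omega) hlt
  rw [pend_succ_ret hb hr, hm.pend_eq, List.tail_cons] at h1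
  exact absurd (lt_of_mem_pend h1) (lt_irrefl _)

lemma right_unique (hm : Matched h w s i j) (hm' : Matched h w s i j') : j = j' :=
  le_antisymm (hm'.right_le hm) (hm.right_le hm')

end Matched

lemma mem_pend_of_unmatched {i k : ℕ} {a : A} (ha : w[i]? = some a) (hc : h.kind a = .call s)
    (hu : ∀ j, ¬ Matched h w s i j) (hik : i < k) : i ∈ pend h w s k := by
  induction k, hik using Nat.le_induction with
  | base => rw [pend_succ_call ha hc]; simp
  | succ k hik ih =>
    rcases pend_succ_cases (h := h) (w := w) (s := s) k with e | ⟨e, -⟩ | ⟨e, hr⟩ <;> rw [e]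
    · exact ih
    · exact List.mem_cons_of_mem _ ih
    · rcases hp : pend h w s k with _ | ⟨x, σ⟩
      · simp [hp] at ih
      · rw [hp] at ih
        rcases List.mem_cons.1 ih with rfl | ih
        · exact absurd (matched_iff.2 ⟨hr, by simp [hp]⟩) (hu k)
        · exact ih

end PendingCalls

namespace MuAny

variable {K : ℕ} {A : Type} {h : CRAlphabet K A} {w : List A} {i i' j j' : ℕ}

lemma lt (hm : MuAny h w i j) : i < j := hm.elim fun _ h => h.lt

lemma lt_length (hm : MuAny h w i j) : j < w.length := hm.elim fun _ h => h.lt_length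

lemma left_unique (hm : MuAny h w i j) (hm' : MuAny h w i' j) : i = i' := by
  obtain ⟨s, hs⟩ := hm
  obtain ⟨t, ht⟩ := hm'
  obtain rfl := hs.stack_unique_right ht
  exact hs.left_unique ht

lemma right_unique (hm : MuAny h w i j) (hm' : MuAny h w i j') : j = j' := by
  obtain ⟨s, hs⟩ := hm
  obtain ⟨t, ht⟩ := hm'
  obtain rfl := hs.stack_unique_left ht
  exact hs.right_unique ht

lemma ret_ne_call (hm : MuAny h w i j) (hm' : MuAny h w j j') : False :=
  hm.elim fun _ h => hm'.elim fun _ h' => h.ret_ne_call h'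

end MuAny

section Runs

variable {K : ℕ} {A Q Γ : Type}

/-- A run presented without stack contents: `q i` is the state before position `i`, and a return
pops the symbol `γ i` pushed at the matching call `i`, or the bottom symbol if there is none. -/
structure NestedRun (h : CRAlphabet K A) (M : MVPA K A Q Γ) (w : List A) (q : ℕ → Q)
    (γ : ℕ → Option Γ) : Prop where
  init : q 0 ∈ M.qI
  final : q w.length ∈ M.qF
  call : ∀ i a s, w[i]? = some a → h.kind a = .call s →
    ∃ g, γ i = some g ∧ M.pushT (q i) a g (q (i + 1))
  int : ∀ i a, w[i]? = some a → h.kind a = .int → M.intT (q i) a (q (i + 1))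
  ret : ∀ i a s, w[i]? = some a → h.kind a = .ret s → ∀ k, MuAny h w k i →
    ∃ g, γ k = some g ∧ M.popT (q i) a (some g) (q (i + 1))
  ret_none : ∀ i a s, w[i]? = some a → h.kind a = .ret s → (∀ k, ¬ MuAny h w k i) →
    M.popT (q i) a none (q (i + 1))

variable {h : CRAlphabet K A} {M : MVPA K A Q Γ} {w : List A}

lemma pend_eq_nil {s : Fin K} {i : ℕ} {a : A} (ha : w[i]? = some a) (hs : h.kind a = .ret s)
    (hu : ∀ k, ¬ MuAny h w k i) : pend h w s i = [] := by
  rcases hp : pend h w s i with _ | ⟨k, σ⟩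
  · rfl
  · exact absurd ⟨s, matched_iff.2 ⟨⟨a, ha, hs⟩, by simp [hp]⟩⟩ (hu k)

lemma matched_of_ret {s : Fin K} {i k : ℕ} {a : A} (ha : w[i]? = some a)
    (hs : h.kind a = .ret s) (hk : MuAny h w k i) : Matched h w s k i := by
  obtain ⟨t, ht⟩ := hk
  obtain ⟨b, hb, hb'⟩ := ht.exists_ret
  rw [ha] at hb; cases hb
  rw [hs] at hb'; cases hb'
  exact ht

lemma matched_of_call {s : Fin K} {i k : ℕ} {a : A} (ha : w[i]? = some a)
    (hs : h.kind a = .call s) (hk : MuAny h w i k) : Matched h w s i k := by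
  obtain ⟨t, ht⟩ := hk
  obtain ⟨b, hb, hb'⟩ := ht.exists_call
  rw [ha] at hb; cases hb
  rw [hs] at hb'; cases hb'
  exact ht

lemma vAccepts_of_nestedRun {q : ℕ → Q} {γ : ℕ → Option Γ} (hr : NestedRun h M w q γ) :
    vAccepts h M w := by
  refine ⟨fun k => (q k, fun s => (pend h w s k).filterMap γ), hr.init, fun s => by simp [pend],
    fun i a ha => ?_, hr.final⟩
  have hother : ∀ t, h.kind a ≠ .call t → h.kind a ≠ .ret t →
      (pend h w t (i + 1)).filterMap γ = (pend h w t i).filterMap γ := fun t hc hr => by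
    rw [pend_succ_of_ne ha hc hr]
  rcases hk : h.kind a with s | s | _
  · obtain ⟨g, hg, hp⟩ := hr.call i a s ha hk
    refine .inl ⟨s, hk, g, hp, ?_, fun t ht => hother t ?_ ?_⟩
    · simp only [pend_succ_call ha hk, List.filterMap_cons, hg]
    · rw [hk]; rintro ⟨⟩; exact ht rfl
    · rw [hk]; rintro ⟨⟩
  · refine .inr (.inl ⟨s, hk, fun t ht => hother t ?_ ?_, ?_⟩)
    · rw [hk]; rintro ⟨⟩
    · rw [hk]; rintro ⟨⟩; exact ht rfl
    by_cases hm : ∃ k, MuAny h w k i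
    · obtain ⟨k, hm⟩ := hm
      obtain ⟨g, hg, hp⟩ := hr.ret i a s ha hk k hm
      refine .inl ⟨g, hp, ?_⟩
      simp only [pend_succ_ret ha hk, (matched_of_ret ha hk hm).pend_eq, List.filterMap_cons, hg,
        List.tail_cons]
    · push Not at hm
      refine .inr ⟨hr.ret_none i a s ha hk hm, ?_, ?_⟩
      · simp only [pend_eq_nil ha hk hm, List.filterMap_nil]
      · simp only [pend_succ_ret ha hk, pend_eq_nil ha hk hm, List.tail_nil, List.filterMap_nil]
  · refine .inr (.inr ⟨hk, hr.int i a ha hk, ?_⟩)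
    funext t
    exact hother t (by rw [hk]; rintro ⟨⟩) (by rw [hk]; rintro ⟨⟩)

lemma exists_nestedRun (hv : vAccepts h M w) : ∃ q γ, NestedRun h M w q γ := by
  classical
  obtain ⟨f, h0, hs0, hstep, hfin⟩ := hv
  have hγ : ∀ i, ∃ o : Option Γ, ∀ a s, w[i]? = some a → h.kind a = .call s →
      ∃ g, o = some g ∧ M.pushT (f i).1 a g (f (i + 1)).1 ∧
        (f (i + 1)).2 s = g :: (f i).2 s := by
    intro i
    by_cases hex : ∃ a s, w[i]? = some a ∧ h.kind a = .call s
    · obtain ⟨a, s, ha, hk⟩ := hex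
      rcases hstep i a ha with ⟨t, ht, g, h1, h2, -⟩ | ⟨t, ht, -⟩ | ⟨ht, -⟩ <;>
        rw [hk] at ht <;> cases ht
      refine ⟨some g, fun b s' hb hs' => ?_⟩
      rw [ha] at hb; cases hb
      rw [hk] at hs'; cases hs'
      exact ⟨g, rfl, h1, h2⟩
    · exact ⟨none, fun a s ha hs => absurd ⟨a, s, ha, hs⟩ hex⟩
  choose γ hγ using hγ
  have hstack : ∀ k ≤ w.length, ∀ s, (f k).2 s = (pend h w s k).filterMap γ := by
    intro k
    induction k with
    | zero => intro _ s; simp [pend, hs0]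
    | succ k ih =>
      intro hk s
      have ha : w[k]? = some w[k] := List.getElem?_eq_getElem hk
      have ih := ih (Nat.le_of_succ_le hk) s
      by_cases hc : h.kind w[k] = .call s
      · obtain ⟨g, hg, -, h2⟩ := hγ k _ s ha hc
        simp only [pend_succ_call ha hc, List.filterMap_cons, hg, h2, ih]
      · by_cases hr : h.kind w[k] = .ret s
        · rcases hstep k _ ha with ⟨t, ht, -⟩ | ⟨t, ht, -, hp⟩ | ⟨ht, -⟩ <;>
            rw [hr] at ht <;> cases ht
          rw [pend_succ_ret ha hr]
          rcases hq : pend h w s k with _ | ⟨i, σ⟩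
          · rw [hq] at ih
            rcases hp with ⟨g, -, hp⟩ | ⟨-, -, hp⟩
            · rw [ih] at hp; simp at hp
            · rw [hp]; simp
          · obtain ⟨hi, ⟨b, hb, hbc⟩, -⟩ := pend_cons (Nat.le_of_succ_le hk) hq
            obtain ⟨g, hg, -, -⟩ := hγ i b s hb hbc
            rw [hq, List.filterMap_cons, hg] at ih
            rcases hp with ⟨g', -, hp⟩ | ⟨-, hp, -⟩
            · rw [ih] at hp
              simpa using (List.cons.inj hp).2.symm
            · rw [ih] at hp; simp at hp
        · rw [pend_succ_of_ne ha hc hr, ← ih]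
          rcases hstep k _ ha with ⟨t, ht, g, -, -, h3⟩ | ⟨t, ht, h3, -⟩ | ⟨-, -, h3⟩
          · exact h3 s (by rintro rfl; exact hc ht)
          · exact h3 s (by rintro rfl; exact hr ht)
          · rw [h3]
  refine ⟨fun k => (f k).1, γ, h0, hfin, ?_, ?_, ?_, ?_⟩
  · intro i a s ha hs
    obtain ⟨g, hg, hp, -⟩ := hγ i a s ha hs
    exact ⟨g, hg, hp⟩
  · intro i a ha hs
    rcases hstep i a ha with ⟨t, ht, -⟩ | ⟨t, ht, -⟩ | ⟨ht, hp, -⟩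
    · rw [hs] at ht; cases ht
    · rw [hs] at ht; cases ht
    · exact hp
  · intro i a s ha hs k hk
    have hm := matched_of_ret ha hs hk
    obtain ⟨b, hb, hbc⟩ := hm.exists_call
    obtain ⟨g, hg, -, -⟩ := hγ k b s hb hbc
    have hst := hstack i hm.lt_length.le s
    rw [hm.pend_eq, List.filterMap_cons, hg] at hst
    rcases hstep i a ha with ⟨t, ht, -⟩ | ⟨t, ht, -, hp⟩ | ⟨ht, -⟩ <;>
      rw [hs] at ht <;> cases ht
    rcases hp with ⟨g', hp, e⟩ | ⟨-, e, -⟩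
    · rw [hst] at e
      obtain rfl := (List.cons.inj e).1
      exact ⟨g, hg, hp⟩
    · rw [hst] at e; simp at e
  · intro i a s ha hs hu
    have hst := hstack i (List.getElem?_eq_some_iff.1 ha).1.le s
    rw [pend_eq_nil ha hs hu] at hst
    rcases hstep i a ha with ⟨t, ht, -⟩ | ⟨t, ht, -, hp⟩ | ⟨ht, -⟩ <;>
      rw [hs] at ht <;> cases ht
    rcases hp with ⟨g', hp, e⟩ | ⟨hp, -⟩
    · rw [hst] at e; simp at e
    · exact hp

end Runs

/-- A tiling system on nested words: local constraints on a labelling of the positions by `C`. -/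
structure TilingSystem (A C : Type) where
  letter : A → C → Prop
  init : C → Prop
  final : C → Prop
  next : C → C → Prop
  nest : C → C → Prop
  noRet : C → Prop
  noCall : C → Prop

/-- The labelling `c` satisfies the constraints of `T` on the nested word of `w`. -/
structure TilingSystem.Valid {K : ℕ} {A C : Type} (T : TilingSystem A C) (h : CRAlphabet K A)
    (w : List A) (c : ℕ → C) : Prop where
  letter : ∀ i a, w[i]? = some a → T.letter a (c i)
  init : 0 < w.length → T.init (c 0)
  final : ∀ i, i + 1 = w.length → T.final (c i)
  next : ∀ i, i + 1 < w.length → T.next (c i) (c (i + 1))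
  nest : ∀ i j, MuAny h w i j → T.nest (c i) (c j)
  noRet : ∀ i < w.length, (∀ j, ¬ MuAny h w i j) → T.noRet (c i)
  noCall : ∀ j < w.length, (∀ i, ¬ MuAny h w i j) → T.noCall (c j)

namespace MVPA

variable {K : ℕ} {A Q Γ : Type}

/-- The tiling system whose tilings are the runs of `M`: a tile records the letter, the states
before and after it, and the pushed symbol. -/
def tiling (h : CRAlphabet K A) (M : MVPA K A Q Γ) : TilingSystem A (A × Q × Q × Option Γ) where
  letter a c := c.1 = a ∧
    (∀ s, h.kind a = .call s → ∃ g, c.2.2.2 = some g ∧ M.pushT c.2.1 a g c.2.2.1) ∧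
    (h.kind a = .int → M.intT c.2.1 a c.2.2.1)
  init c := c.2.1 ∈ M.qI
  final c := c.2.2.1 ∈ M.qF
  next c c' := c.2.2.1 = c'.2.1
  nest c c' := ∃ g, c.2.2.2 = some g ∧ M.popT c'.2.1 c'.1 (some g) c'.2.2.1
  noRet _ := True
  noCall c := ∀ s, h.kind c.1 = .ret s → M.popT c.2.1 c.1 none c.2.2.1

lemma vAccepts_iff_tiling {h : CRAlphabet K A} {M : MVPA K A Q Γ} {w : List A} (hw : w ≠ []) :
    vAccepts h M w ↔ ∃ c, (M.tiling h).Valid h w c := by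
  constructor
  · intro hv
    obtain ⟨q, γ, hr⟩ := exists_nestedRun hv
    obtain ⟨a₀, -⟩ := List.exists_mem_of_ne_nil w hw
    have key : ∀ i a, w[i]? = some a → w.getD i a₀ = a := fun i a ha => by
      simp [List.getD, ha]
    refine ⟨fun i => (w.getD i a₀, q i, q (i + 1), γ i), ?_, fun _ => hr.init, ?_, fun _ _ => rfl,
      ?_, fun _ _ _ => trivial, ?_⟩
    · exact fun i a ha => ⟨key i a ha, fun s hs => hr.call i a s ha hs, hr.int i a ha⟩
    · intro i hi
      change q (i + 1) ∈ M.qF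
      rw [hi]; exact hr.final
    · rintro i j ⟨s, hm⟩
      obtain ⟨b, hb, hs⟩ := hm.exists_ret
      obtain ⟨g, hg, hp⟩ := hr.ret j b s hb hs i ⟨s, hm⟩
      exact ⟨g, hg, by simpa only [key j b hb] using hp⟩
    · intro j hj hu s hs
      have hb : w[j]? = some w[j] := List.getElem?_eq_getElem hj
      simp only [key j _ hb] at hs ⊢
      exact hr.ret_none j _ s hb hs hu
  · rintro ⟨c, hc⟩
    have hpos : 0 < w.length := List.length_pos_iff.2 hw
    set q : ℕ → Q := fun k => if k = 0 then (c 0).2.1 else (c (k - 1)).2.2.1 with hq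
    have hq1 : ∀ k, q (k + 1) = (c k).2.2.1 := fun k => by simp [hq]
    have hq0 : ∀ k < w.length, q k = (c k).2.1 := by
      rintro (_ | k) hk
      · simp [hq]
      · rw [hq1, hc.next k hk]
    apply vAccepts_of_nestedRun (q := q) (γ := fun i => (c i).2.2.2)
    have hlt : ∀ {i a}, w[i]? = some a → i < w.length := fun ha =>
      (List.getElem?_eq_some_iff.1 ha).1
    refine ⟨?_, ?_, ?_, ?_, ?_, ?_⟩
    · rw [hq0 0 hpos]; exact hc.init hpos
    · obtain ⟨n, hn⟩ := Nat.exists_eq_succ_of_ne_zero hpos.ne'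
      rw [hn, Nat.succ_eq_add_one, hq1]; exact hc.final n hn.symm
    · intro i a s ha hs
      rw [hq1, hq0 i (hlt ha)]
      exact (hc.letter i a ha).2.1 s hs
    · intro i a ha hs
      rw [hq1, hq0 i (hlt ha)]
      exact (hc.letter i a ha).2.2 hs
    · intro i a s ha hs k hk
      obtain ⟨g, hg, hp⟩ := hc.nest k i hk
      rw [hq1, hq0 i (hlt ha)]
      rw [(hc.letter i a ha).1] at hp
      exact ⟨g, hg, hp⟩
    · intro i a s ha hs hu
      have hp := hc.noCall i (hlt ha) hu
      simp only [tiling, (hc.letter i a ha).1] at hp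
      rw [hq1, hq0 i (hlt ha)]
      exact hp s hs

end MVPA

namespace TilingSystem

variable {K : ℕ} {A C : Type}

/-- `c` may be the tile following the optional tile `p`. -/
def Follows (T : TilingSystem A C) : Option C → C → Prop
  | none, c => T.init c
  | some p, c => T.next p c

/-- The automaton guessing a tiling. For every stack it remembers whether some pending call has
been guessed to be matched; pushed symbols store the tile, that guess for the current call, and the
bit to be restored on popping. -/
def automaton (T : TilingSystem A C) (h : CRAlphabet K A) :
    MVPA K A (Option C × (Fin K → Bool)) (C × Bool × Bool) where
  pushT p a g p' := p'.1 = some g.1 ∧ T.letter a g.1 ∧ T.Follows p.1 g.1 ∧ T.noCall g.1 ∧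
    ∃ s, h.kind a = .call s ∧ g.2.2 = p.2 s ∧
      ((g.2.1 = true ∧ p'.2 = Function.update p.2 s true) ∨
        (g.2.1 = false ∧ p.2 s = false ∧ p'.2 = p.2 ∧ T.noRet g.1))
  popT p a o p' := ∃ c, p'.1 = some c ∧ T.letter a c ∧ T.Follows p.1 c ∧ T.noRet c ∧
    match o with
    | none => T.noCall c ∧ p'.2 = p.2
    | some g => ∃ s, h.kind a = .ret s ∧ g.2.1 = true ∧ T.nest g.1 c ∧
        p'.2 = Function.update p.2 s g.2.2
  intT p a p' := ∃ c, p'.1 = some c ∧ T.letter a c ∧ T.Follows p.1 c ∧ T.noRet c ∧ T.noCall c ∧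
    p'.2 = p.2
  qI := {(none, fun _ => false)}
  qF := {p | (∀ s, p.2 s = false) ∧ ∃ c, p.1 = some c ∧ T.final c}

variable {T : TilingSystem A C} {h : CRAlphabet K A} {w : List A}

/-- Some matched call of stack `s` is pending after reading `k` letters. -/
def PendingMatched (h : CRAlphabet K A) (w : List A) (k : ℕ) (s : Fin K) : Prop :=
  ∃ i j, Matched h w s i j ∧ i < k ∧ k ≤ j

lemma pendingMatched_succ_of_ne {i : ℕ} {a : A} {s : Fin K} (ha : w[i]? = some a)
    (hc : h.kind a ≠ .call s) (hr : h.kind a ≠ .ret s) :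
    PendingMatched h w (i + 1) s ↔ PendingMatched h w i s := by
  constructor
  · rintro ⟨x, y, hm, h1, h2⟩
    refine ⟨x, y, hm, ?_, by omega⟩
    rcases Nat.lt_succ_iff_lt_or_eq.1 h1 with h1 | rfl
    · exact h1
    · obtain ⟨b, hb, hb'⟩ := hm.exists_call
      rw [ha] at hb; cases hb; exact absurd hb' hc
  · rintro ⟨x, y, hm, h1, h2⟩
    refine ⟨x, y, hm, by omega, ?_⟩
    rcases h2.lt_or_eq with h2 | rfl
    · exact h2
    · obtain ⟨b, hb, hb'⟩ := hm.exists_ret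
      rw [ha] at hb; cases hb; exact absurd hb' hr

lemma not_pendingMatched_of_unmatched_call {i : ℕ} {a : A} {s : Fin K} (ha : w[i]? = some a)
    (hc : h.kind a = .call s) (hu : ∀ j, ¬ MuAny h w i j) : ¬ PendingMatched h w i s := by
  rintro ⟨x, y, hm, h1, h2⟩
  have hiy : i < y := by
    refine lt_of_le_of_ne h2 ?_
    rintro rfl
    obtain ⟨b, hb, hb'⟩ := hm.exists_ret
    rw [ha] at hb; cases hb; rw [hc] at hb'; cases hb'
  have h3 := mem_pend_of_unmatched ha hc (fun j hj => hu j ⟨s, hj⟩) hiy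
  have h4 := pairwise_pend (h := h) (w := w) (s := s) y
  rw [hm.pend_eq] at h3 h4
  rcases List.mem_cons.1 h3 with h3 | h3
  · omega
  · have := (List.pairwise_cons.1 h4).1 _ h3
    omega

lemma pendingMatched_succ_ret {i j : ℕ} {s : Fin K} (hm : Matched h w s i j) :
    PendingMatched h w (j + 1) s ↔ PendingMatched h w i s := by
  have hij := hm.lt
  constructor
  · rintro ⟨x, y, hm', h1, h2⟩
    have hxj : x ≠ j := by rintro rfl; exact hm.ret_ne_call hm'
    have hxi : x ≠ i := by rintro rfl; have := hm.right_unique hm'; omega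
    have := hm.not_cross hm'
    exact ⟨x, y, hm', by omega, by omega⟩
  · rintro ⟨x, y, hm', h1, h2⟩
    have hyi : y ≠ i := by rintro rfl; exact hm'.ret_ne_call hm
    have hyj : y ≠ j := by rintro rfl; have := hm.left_unique hm'; omega
    have := hm'.not_cross hm
    exact ⟨x, y, hm', by omega, by omega⟩

lemma pendingMatched_succ_unmatched_ret {j : ℕ} {a : A} {s : Fin K} (ha : w[j]? = some a)
    (hr : h.kind a = .ret s) (hu : ∀ i, ¬ MuAny h w i j) :
    PendingMatched h w (j + 1) s ↔ PendingMatched h w j s := by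
  constructor
  · rintro ⟨x, y, hm', h1, h2⟩
    refine ⟨x, y, hm', ?_, by omega⟩
    rcases Nat.lt_succ_iff_lt_or_eq.1 h1 with h1 | rfl
    · exact h1
    · obtain ⟨b, hb, hb'⟩ := hm'.exists_call
      rw [ha] at hb; cases hb; rw [hr] at hb'; cases hb'
  · rintro ⟨x, y, hm', h1, h2⟩
    refine ⟨x, y, hm', by omega, ?_⟩
    rcases h2.lt_or_eq with h2 | rfl
    · exact h2
    · exact absurd ⟨s, hm'⟩ (hu x)

open Classical in
lemma vAccepts_automaton_of_valid {c : ℕ → C} (hw : w ≠ []) (hc : T.Valid h w c) :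
    vAccepts h (T.automaton h) w := by
  have hpos : 0 < w.length := List.length_pos_iff.2 hw
  let q : ℕ → Option C × (Fin K → Bool) := fun k =>
    (if k = 0 then none else some (c (k - 1)), fun s => decide (PendingMatched h w k s))
  let γ : ℕ → Option (C × Bool × Bool) := fun i =>
    some (c i, decide (∃ j, MuAny h w i j),
      decide (∃ a s, w[i]? = some a ∧ h.kind a = .call s ∧ PendingMatched h w i s))
  have hq1 : ∀ i, (q (i + 1)).1 = some (c i) := fun i => by simp [q]
  have hlt : ∀ {i a}, w[i]? = some a → i < w.length := fun ha =>
    (List.getElem?_eq_some_iff.1 ha).1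
  have hfol : ∀ i < w.length, T.Follows (q i).1 (c i) := by
    rintro (_ | i) hi
    · exact hc.init hi
    · rw [hq1]; exact hc.next i hi
  have hnoRet : ∀ i a, w[i]? = some a → (∀ s, h.kind a ≠ .call s) → T.noRet (c i) :=
    fun i a ha hk => hc.noRet i (hlt ha) fun j ⟨s, hm⟩ => by
      obtain ⟨b, hb, hb'⟩ := hm.exists_call
      rw [ha] at hb; cases hb; exact hk s hb'
  have hnoCall : ∀ i a, w[i]? = some a → (∀ s, h.kind a ≠ .ret s) → T.noCall (c i) :=
    fun i a ha hk => hc.noCall i (hlt ha) fun j ⟨s, hm⟩ => by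
      obtain ⟨b, hb, hb'⟩ := hm.exists_ret
      rw [ha] at hb; cases hb; exact hk s hb'
  apply vAccepts_of_nestedRun (q := q) (γ := γ)
  refine ⟨?_, ?_, ?_, ?_, ?_, ?_⟩
  · refine Set.mem_singleton_iff.2 (Prod.ext (by simp [q]) (funext fun s => ?_))
    simp [q, PendingMatched]
  · refine ⟨fun s => ?_, c (w.length - 1), by simp [q, hpos.ne'], hc.final _ (by omega)⟩
    simp only [q, decide_eq_false_iff_not]
    rintro ⟨i, j, hm, -, h2⟩
    exact absurd hm.lt_length (by omega)
  · intro i a s ha hs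
    refine ⟨_, rfl, hq1 i, hc.letter i a ha, hfol i (hlt ha),
      hnoCall i a ha (by simp [hs]), s, hs, ?_, ?_⟩
    · simp only [q, decide_eq_decide]
      constructor
      · rintro ⟨b, t, hb, ht, hp⟩
        rw [ha] at hb; cases hb; rw [hs] at ht; cases ht; exact hp
      · exact fun hp => ⟨a, s, ha, hs, hp⟩
    · by_cases hm : ∃ j, MuAny h w i j
      · refine .inl ⟨by simpa using hm, ?_⟩
        obtain ⟨j, hm⟩ := hm
        have hm := matched_of_call ha hs hm
        funext t
        by_cases ht : t = s
        · subst ht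
          simp only [q, Function.update_self, decide_eq_true_eq]
          exact ⟨i, j, hm, Nat.lt_succ_self i, hm.lt⟩
        · simp only [q, Function.update_of_ne ht, decide_eq_decide]
          exact pendingMatched_succ_of_ne ha (by rw [hs]; rintro ⟨⟩; exact ht rfl) (by simp [hs])
      · have hm' : ∀ j, ¬ MuAny h w i j := by push Not at hm; exact hm
        have hnp := not_pendingMatched_of_unmatched_call ha hs hm'
        refine .inr ⟨by simpa using hm, by simpa [q] using hnp, ?_, hc.noRet i (hlt ha) hm'⟩
        funext t
        simp only [q, decide_eq_decide]
        by_cases ht : t = s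
        · subst ht
          refine iff_of_false ?_ hnp
          rintro ⟨x, y, hxy, h1, h2⟩
          rcases Nat.lt_succ_iff_lt_or_eq.1 h1 with h1 | rfl
          · exact hnp ⟨x, y, hxy, h1, by omega⟩
          · exact hm' y ⟨t, hxy⟩
        · exact pendingMatched_succ_of_ne ha (by rw [hs]; rintro ⟨⟩; exact ht rfl) (by simp [hs])
  · intro i a ha hs
    refine ⟨c i, hq1 i, hc.letter i a ha, hfol i (hlt ha), hnoRet i a ha (by simp [hs]),
      hnoCall i a ha (by simp [hs]), funext fun t => ?_⟩
    simp only [q, decide_eq_decide]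
    exact pendingMatched_succ_of_ne ha (by simp [hs]) (by simp [hs])
  · intro i a s ha hs k hk
    have hm := matched_of_ret ha hs hk
    obtain ⟨b, hb, hb'⟩ := hm.exists_call
    refine ⟨_, rfl, c i, hq1 i, hc.letter i a ha, hfol i (hlt ha), hnoRet i a ha (by simp [hs]),
      s, hs, by simpa using ⟨i, hk⟩, hc.nest k i hk, funext fun t => ?_⟩
    by_cases ht : t = s
    · subst ht
      simp only [q, Function.update_self, decide_eq_decide, pendingMatched_succ_ret hm]
      constructor
      · exact fun hp => ⟨b, t, hb, hb', hp⟩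
      · rintro ⟨b', t', h1, h2, hp⟩
        rw [hb] at h1; cases h1; rw [hb'] at h2; cases h2; exact hp
    · simp only [q, Function.update_of_ne ht, decide_eq_decide]
      exact pendingMatched_succ_of_ne ha (by simp [hs]) (by rw [hs]; rintro ⟨⟩; exact ht rfl)
  · intro i a s ha hs hu
    refine ⟨c i, hq1 i, hc.letter i a ha, hfol i (hlt ha), hnoRet i a ha (by simp [hs]),
      hc.noCall i (hlt ha) hu, funext fun t => ?_⟩
    simp only [q, decide_eq_decide]
    by_cases ht : t = s
    · subst ht
      exact pendingMatched_succ_unmatched_ret ha hs hu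
    · exact pendingMatched_succ_of_ne ha (by simp [hs]) (by rw [hs]; rintro ⟨⟩; exact ht rfl)

lemma claimed_call_matched {q : ℕ → Option C × (Fin K → Bool)}
    {γ : ℕ → Option (C × Bool × Bool)} (hr : NestedRun h (T.automaton h) w q γ) {i : ℕ} {a : A}
    {s : Fin K} {g : C × Bool × Bool} (ha : w[i]? = some a) (hs : h.kind a = .call s)
    (hg : γ i = some g) (hclaim : g.2.1 = true) : ∃ j, MuAny h w i j := by
  by_contra! hu
  have hi : i < w.length := (List.getElem?_eq_some_iff.1 ha).1
  have key : ∀ k, i < k → k ≤ w.length → (q k).2 s = true := by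
    intro k
    induction k using Nat.strong_induction_on with
    | _ k ih =>
      intro hik hk
      obtain _ | k := k
      · omega
      have hb : w[k]? = some w[k] := List.getElem?_eq_getElem hk
      rcases (Nat.lt_succ_iff.1 hik).eq_or_lt with rfl | hik'
      · rw [ha] at hb
        obtain ⟨g', hg', -, -, -, -, t, ht, -, hp⟩ := hr.call i a s ha hs
        rw [hg] at hg'; cases hg'
        rw [hs] at ht; cases ht
        rcases hp with ⟨-, hp⟩ | ⟨hp, -⟩
        · rw [hp]; simp
        · rw [hclaim] at hp; cases hp
      have ihk := ih k (Nat.lt_succ_self k) hik' (Nat.le_of_succ_le hk)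
      rcases hkind : h.kind w[k] with t | t | _
      · obtain ⟨g', hg', -, -, -, -, t', ht, -, hp⟩ := hr.call k _ t hb hkind
        rw [hkind] at ht; cases ht
        rcases hp with ⟨-, hp⟩ | ⟨-, -, hp, -⟩
        · rw [hp]
          by_cases hst : s = t
          · subst hst; simp
          · rwa [Function.update_of_ne hst]
        · rwa [hp]
      · by_cases hm : ∃ x, MuAny h w x k
        · obtain ⟨x, hx⟩ := hm
          obtain ⟨g', hg', c, -, -, -, -, t', ht, -, -, hp⟩ := hr.ret k _ t hb hkind x hx
          rw [hkind] at ht; cases ht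
          rw [hp]
          by_cases hst : s = t
          · subst hst
            rw [Function.update_self]
            have hm := matched_of_ret hb hkind hx
            obtain ⟨b, hb', hbc⟩ := hm.exists_call
            have h3 := mem_pend_of_unmatched ha hs (fun j hj => hu j ⟨s, hj⟩) hik'
            have hix : i < x := by
              rw [hm.pend_eq] at h3
              rcases List.mem_cons.1 h3 with rfl | h3
              · exact absurd hx (hu k)
              · exact lt_of_mem_pend h3
            obtain ⟨g₂, hg₂, -, -, -, -, t', ht, hold, -⟩ := hr.call x b s hb' hbc
            rw [hg'] at hg₂; cases hg₂
            rw [hbc] at ht; cases ht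
            rw [hold]
            exact ih x (by have := hm.lt; omega) hix (by have := hm.lt; omega)
          · rwa [Function.update_of_ne hst]
        · push Not at hm
          obtain ⟨c, -, -, -, -, -, hp⟩ := hr.ret_none k _ t hb hkind hm
          rwa [hp]
      · obtain ⟨c, -, -, -, -, -, hp⟩ := hr.int k _ hb hkind
        rwa [hp]
  have h1 := key w.length hi le_rfl
  rw [hr.final.1 s] at h1
  cases h1

lemma exists_valid_of_vAccepts_automaton (hv : vAccepts h (T.automaton h) w) :
    ∃ c, T.Valid h w c := by
  obtain ⟨q, γ, hr⟩ := exists_nestedRun hv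
  have hq0 : (q 0).1 = none := by
    have := hr.init
    rw [show q 0 = (none, fun _ => false) from this]
  have hstep : ∀ i a, w[i]? = some a → ∃ c, (q (i + 1)).1 = some c ∧ T.letter a c ∧
      T.Follows (q i).1 c ∧ ((∀ j, ¬ MuAny h w i j) → T.noRet c) ∧
      ((∀ j, ¬ MuAny h w j i) → T.noCall c) ∧
      (∀ s, h.kind a = .call s → ∃ g, γ i = some g ∧ g.1 = c) ∧
      (∀ j, MuAny h w j i → ∃ g, γ j = some g ∧ T.nest g.1 c) := by
    intro i a ha
    have hno : (∀ s, h.kind a ≠ .ret s) → ∀ j, ¬ MuAny h w j i := by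
      rintro hk j ⟨s, hm⟩
      obtain ⟨b, hb, hb'⟩ := hm.exists_ret
      rw [ha] at hb; cases hb; exact hk s hb'
    rcases hk : h.kind a with s | s | _
    · obtain ⟨g, hg, h1, h2, h3, h4, t, ht, -, hp⟩ := hr.call i a s ha hk
      refine ⟨g.1, h1, h2, h3, fun hu => ?_, fun _ => h4, fun t ht => ⟨g, hg, rfl⟩, fun j hj =>
        absurd hj (hno (by simp [hk]) j)⟩
      rcases hp with ⟨hp, -⟩ | ⟨-, -, -, hp⟩
      · obtain ⟨j, hj⟩ := claimed_call_matched hr ha hk hg hp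
        exact absurd hj (hu j)
      · exact hp
    · by_cases hm : ∃ x, MuAny h w x i
      · obtain ⟨x, hx⟩ := hm
        obtain ⟨g, hg, c, h1, h2, h3, h4, t, ht, -, hp, -⟩ := hr.ret i a s ha hk x hx
        refine ⟨c, h1, h2, h3, fun _ => h4, fun hu => absurd hx (hu x), (by rintro t ⟨⟩), ?_⟩
        intro j hj
        obtain rfl := hj.left_unique hx
        exact ⟨g, hg, hp⟩
      · push Not at hm
        obtain ⟨c, h1, h2, h3, h4, h5, -⟩ := hr.ret_none i a s ha hk hm
        exact ⟨c, h1, h2, h3, fun _ => h4, fun _ => h5, (by rintro t ⟨⟩),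
          fun j hj => absurd hj (hm j)⟩
    · obtain ⟨c, h1, h2, h3, h4, h5, -⟩ := hr.int i a ha hk
      exact ⟨c, h1, h2, h3, fun _ => h4, fun _ => h5, (by rintro t ⟨⟩),
        fun j hj => absurd hj (hno (by simp [hk]) j)⟩
  obtain ⟨-, c₀, -⟩ := hr.final
  let c : ℕ → C := fun i => ((q (i + 1)).1).getD c₀
  have hc : ∀ i a, w[i]? = some a → (q (i + 1)).1 = some (c i) := fun i a ha => by
    obtain ⟨c', h1, -⟩ := hstep i a ha
    simp [c, h1]
  have hstep' : ∀ i a, w[i]? = some a → T.letter a (c i) ∧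
      T.Follows (q i).1 (c i) ∧ ((∀ j, ¬ MuAny h w i j) → T.noRet (c i)) ∧
      ((∀ j, ¬ MuAny h w j i) → T.noCall (c i)) ∧
      (∀ s, h.kind a = .call s → ∃ g, γ i = some g ∧ g.1 = c i) ∧
      (∀ j, MuAny h w j i → ∃ g, γ j = some g ∧ T.nest g.1 (c i)) := fun i a ha => by
    obtain ⟨c', h1, h2⟩ := hstep i a ha
    rw [hc i a ha] at h1; cases h1
    exact h2
  have hget : ∀ i, (hi : i < w.length) → w[i]? = some w[i] := fun i hi =>
    List.getElem?_eq_getElem hi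
  refine ⟨c, fun i a ha => (hstep' i a ha).1, fun h0 => ?_, fun i hi => ?_, fun i hi => ?_,
    fun i j hm => ?_, fun i hi => (hstep' i _ (hget i hi)).2.2.1,
    fun i hi => (hstep' i _ (hget i hi)).2.2.2.1⟩
  · have := (hstep' 0 _ (hget 0 h0)).2.1
    rwa [hq0] at this
  · obtain ⟨-, c', h1, h2⟩ := hr.final
    rw [← hi, hc i _ (hget i (by omega))] at h1
    cases h1; exact h2
  · have := (hstep' (i + 1) _ (hget _ hi)).2.1
    rwa [hc i _ (hget i (by omega))] at this
  · obtain ⟨s, hs⟩ := id hm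
    obtain ⟨a, ha, hk⟩ := hs.exists_call
    obtain ⟨b, hb, -⟩ := hs.exists_ret
    obtain ⟨g, hg, h1⟩ := (hstep' i a ha).2.2.2.2.1 s hk
    obtain ⟨g', hg', h2⟩ := (hstep' j b hb).2.2.2.2.2 i hm
    rw [hg] at hg'; cases hg'
    rwa [h1] at h2

lemma vAccepts_automaton_iff (hw : w ≠ []) :
    vAccepts h (T.automaton h) w ↔ ∃ c, T.Valid h w c :=
  ⟨exists_valid_of_vAccepts_automaton, fun ⟨_, hc⟩ => vAccepts_automaton_of_valid hw hc⟩

end TilingSystem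

section Definability

variable {K : ℕ} {A : Type} {h : CRAlphabet K A}

/-- A property of nested words with valuations that is expressed by a first-order formula. -/
def FODefinable (h : CRAlphabet K A) (R : List A → (ℕ → ℕ) → (ℕ → Set ℕ) → Prop) : Prop :=
  ∃ φ : MSO A, FirstOrder φ ∧ ∀ w ν μ, Sat h w φ ν μ ↔ R w ν μ

namespace FODefinable

variable {R S : List A → (ℕ → ℕ) → (ℕ → Set ℕ) → Prop}

lemma congr (hR : FODefinable h R) (he : ∀ w ν μ, R w ν μ ↔ S w ν μ) : FODefinable h S := by
  obtain ⟨φ, h1, h2⟩ := hR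
  exact ⟨φ, h1, fun w ν μ => (h2 w ν μ).trans (he w ν μ)⟩

lemma lab (a : A) (x : ℕ) : FODefinable h fun w ν _ => w[ν x]? = some a :=
  ⟨.lab a x, trivial, fun _ _ _ => Iff.rfl⟩

lemma succ (x y : ℕ) : FODefinable h fun w ν _ => ν y = ν x + 1 ∧ ν y < w.length :=
  ⟨.succ x y, trivial, fun _ _ _ => Iff.rfl⟩

lemma mu (x y : ℕ) : FODefinable h fun w ν _ => MuAny h w (ν x) (ν y) :=
  ⟨.mu x y, trivial, fun _ _ _ => Iff.rfl⟩

lemma mem (x X : ℕ) : FODefinable h fun _ ν μ => ν x ∈ μ X :=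
  ⟨.mem x X, trivial, fun _ _ _ => Iff.rfl⟩

lemma not (hR : FODefinable h R) : FODefinable h fun w ν μ => ¬ R w ν μ := by
  obtain ⟨φ, h1, h2⟩ := hR
  exact ⟨.not φ, h1, fun w ν μ => not_congr (h2 w ν μ)⟩

lemma or (hR : FODefinable h R) (hS : FODefinable h S) :
    FODefinable h fun w ν μ => R w ν μ ∨ S w ν μ := by
  obtain ⟨φ, h1, h2⟩ := hR
  obtain ⟨ψ, h3, h4⟩ := hS
  exact ⟨.or φ ψ, ⟨h1, h3⟩, fun w ν μ => or_congr (h2 w ν μ) (h4 w ν μ)⟩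

lemma and (hR : FODefinable h R) (hS : FODefinable h S) :
    FODefinable h fun w ν μ => R w ν μ ∧ S w ν μ :=
  (hR.not.or hS.not).not.congr fun _ _ _ => by tauto

lemma ex (x : ℕ) (hR : FODefinable h R) :
    FODefinable h fun w ν μ => ∃ i < w.length, R w (Function.update ν x i) μ := by
  obtain ⟨φ, h1, h2⟩ := hR
  exact ⟨.ex1 x φ, h1, fun w ν μ =>
    exists_congr fun i => and_congr_right fun _ => h2 w _ μ⟩

lemma all (x : ℕ) (hR : FODefinable h R) :
    FODefinable h fun w ν μ => ∀ i < w.length, R w (Function.update ν x i) μ :=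
  (hR.not.ex x).not.congr fun _ _ _ => by push Not; rfl

lemma false : FODefinable h fun _ _ _ => False :=
  (FODefinable.mem 0 0 |>.and (FODefinable.mem 0 0).not).congr fun _ _ _ => by tauto

lemma of_prop (p : Prop) : FODefinable h fun _ _ _ => p := by
  by_cases hp : p
  · exact false.not.congr fun _ _ _ => by simp [hp]
  · exact false.congr fun _ _ _ => by simp [hp]

lemma exists_finite {ι : Type*} [Finite ι]
    {R : ι → List A → (ℕ → ℕ) → (ℕ → Set ℕ) → Prop} (hR : ∀ t, FODefinable h (R t)) :
    FODefinable h fun w ν μ => ∃ t, R t w ν μ := by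
  have key : ∀ s : Set ι, s.Finite → FODefinable h fun w ν μ => ∃ t ∈ s, R t w ν μ := by
    intro s hs
    induction s, hs using Set.Finite.induction_on with
    | empty => exact false.congr fun _ _ _ => by simp
    | @insert a s _ _ ih => exact ((hR a).or ih).congr fun _ _ _ => by simp
  exact (key _ Set.finite_univ).congr fun _ _ _ => by simp

end FODefinable

/-- Existential quantification of the set variables `0, …, N - 1`. -/
def MSO.exSets (φ : MSO A) : ℕ → MSO A
  | 0 => φ
  | N + 1 => .ex2 N (φ.exSets N)

lemma isEMSO_exSets {φ : MSO A} (hφ : FirstOrder φ) (N : ℕ) : IsEMSO (φ.exSets N) := by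
  induction N with
  | zero => exact .fo hφ
  | succ N ih => exact .ex ih

lemma sat_exSets {φ : MSO A} {w : List A} {ν : ℕ → ℕ} {N : ℕ} : ∀ {μ : ℕ → Set ℕ},
    Sat h w (φ.exSets N) ν μ ↔ ∃ μ', (∀ X < N, μ' X ⊆ {i | i < w.length}) ∧
      (∀ X, N ≤ X → μ' X = μ X) ∧ Sat h w φ ν μ' := by
  induction N with
  | zero =>
    intro μ
    constructor
    · exact fun hs => ⟨μ, by simp, fun _ _ => rfl, hs⟩
    · rintro ⟨μ', -, h2, hs⟩
      rwa [show μ' = μ from funext fun X => h2 X (Nat.zero_le X)] at hs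
  | succ N ih =>
    intro μ
    simp only [MSO.exSets, Sat, ih]
    constructor
    · rintro ⟨S, hS, μ', h1, h2, hs⟩
      refine ⟨μ', fun X hX => ?_, fun X hX => ?_, hs⟩
      · rcases Nat.lt_succ_iff_lt_or_eq.1 hX with hX | rfl
        · exact h1 X hX
        · rw [h2 X le_rfl, Function.update_self]; exact hS
      · rw [h2 X (by omega), Function.update_of_ne (by omega)]
    · rintro ⟨μ', h1, h2, hs⟩
      refine ⟨μ' N, h1 N (Nat.lt_succ_self N), μ', fun X hX => h1 X (by omega), fun X hX => ?_, hs⟩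
      by_cases hXN : X = N
      · subst hXN; simp
      · rw [Function.update_of_ne hXN, h2 X (by omega)]

end Definability

namespace TilingSystem

variable {K : ℕ} {A C : Type}

/-- The sets `X (e t)` encode a tiling. -/
structure Encodes (T : TilingSystem A C) (h : CRAlphabet K A) (w : List A) (e : C → ℕ)
    (X : ℕ → Set ℕ) : Prop where
  unique : ∀ i < w.length, ¬ ∃ p : C × C, p.1 ≠ p.2 ∧ i ∈ X (e p.1) ∧ i ∈ X (e p.2)
  letter : ∀ i < w.length, ∃ p : A × C, T.letter p.1 p.2 ∧ w[i]? = some p.1 ∧ i ∈ X (e p.2)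
  init : ∀ i < w.length, (∃ j < w.length, i = j + 1 ∧ i < w.length) ∨
    ∃ t, T.init t ∧ i ∈ X (e t)
  final : ∀ i < w.length, (∃ j < w.length, j = i + 1 ∧ j < w.length) ∨
    ∃ t, T.final t ∧ i ∈ X (e t)
  next : ∀ i < w.length, ∀ j < w.length, ¬ (j = i + 1 ∧ j < w.length) ∨
    ∃ p : C × C, T.next p.1 p.2 ∧ i ∈ X (e p.1) ∧ j ∈ X (e p.2)
  nest : ∀ i < w.length, ∀ j < w.length, ¬ MuAny h w i j ∨
    ∃ p : C × C, T.nest p.1 p.2 ∧ i ∈ X (e p.1) ∧ j ∈ X (e p.2)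
  noRet : ∀ i < w.length, (∃ j < w.length, MuAny h w i j) ∨ ∃ t, T.noRet t ∧ i ∈ X (e t)
  noCall : ∀ i < w.length, (∃ j < w.length, MuAny h w j i) ∨ ∃ t, T.noCall t ∧ i ∈ X (e t)

lemma foDefinable_encodes [Finite A] [Finite C] (T : TilingSystem A C) (h : CRAlphabet K A)
    (e : C → ℕ) : FODefinable h fun w _ X => T.Encodes h w e X := by
  have tile : ∀ (p : C → Prop) (x : ℕ),
      FODefinable h fun _ ν X => ∃ t, p t ∧ ν x ∈ X (e t) := fun p x =>
    .exists_finite fun t => (FODefinable.of_prop (p t)).and (.mem x (e t))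
  have tiles : ∀ (p : C → C → Prop) (x y : ℕ),
      FODefinable h fun _ ν X => ∃ t : C × C, p t.1 t.2 ∧ ν x ∈ X (e t.1) ∧ ν y ∈ X (e t.2) :=
    fun p x y => .exists_finite fun t => (FODefinable.of_prop (p t.1 t.2)).and
      ((FODefinable.mem x (e t.1)).and (.mem y (e t.2)))
  have h1 := (tiles (· ≠ ·) 0 0).not.all 0
  have h2 := (FODefinable.exists_finite (h := h) fun p : A × C =>
    (FODefinable.of_prop (T.letter p.1 p.2)).and
      ((FODefinable.lab p.1 0).and (.mem 0 (e p.2)))).all 0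
  have h3 := (((FODefinable.succ (h := h) 1 0).ex 1).or (tile T.init 0)).all 0
  have h4 := (((FODefinable.succ (h := h) 0 1).ex 1).or (tile T.final 0)).all 0
  have h5 := (((FODefinable.succ (h := h) 0 1).not.or (tiles T.next 0 1)).all 1).all 0
  have h6 := (((FODefinable.mu (h := h) 0 1).not.or (tiles T.nest 0 1)).all 1).all 0
  have h7 := (((FODefinable.mu (h := h) 0 1).ex 1).or (tile T.noRet 0)).all 0
  have h8 := (((FODefinable.mu (h := h) 1 0).ex 1).or (tile T.noCall 0)).all 0
  refine (h1.and <| h2.and <| h3.and <| h4.and <| h5.and <| h6.and <| h7.and h8).congr ?_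
  intro w ν X
  simp only [Function.update_self, ne_eq, zero_ne_one, not_false_eq_true,
    Function.update_of_ne]
  exact ⟨fun ⟨a, b, c, d, e, f, g, i⟩ => ⟨a, b, c, d, e, f, g, i⟩,
    fun ⟨a, b, c, d, e, f, g, i⟩ => ⟨a, b, c, d, e, f, g, i⟩⟩

lemma encodes_of_valid {T : TilingSystem A C} {h : CRAlphabet K A} {w : List A} {c : ℕ → C}
    (hc : T.Valid h w c) {e : C → ℕ} {X : ℕ → Set ℕ}
    (hX : ∀ t, X (e t) = {i | i < w.length ∧ c i = t}) : T.Encodes h w e X := by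
  have hmem : ∀ i < w.length, i ∈ X (e (c i)) := fun i hi => by rw [hX]; exact ⟨hi, rfl⟩
  refine ⟨?_, fun i hi => ?_, fun i hi => ?_, fun i hi => ?_, fun i hi j hj => ?_,
    fun i hi j hj => ?_, fun i hi => ?_, fun i hi => ?_⟩
  · rintro i hi ⟨⟨t, t'⟩, hne, h1, h2⟩
    rw [hX] at h1 h2
    exact hne (h1.2.symm.trans h2.2)
  · exact ⟨(w[i], c i), hc.letter i _ (List.getElem?_eq_getElem hi),
      List.getElem?_eq_getElem hi, hmem i hi⟩
  · obtain _ | i := i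
    · exact .inr ⟨_, hc.init hi, hmem 0 hi⟩
    · exact .inl ⟨i, by omega, rfl, hi⟩
  · by_cases hl : i + 1 = w.length
    · exact .inr ⟨_, hc.final i hl, hmem i hi⟩
    · exact .inl ⟨i + 1, by omega, rfl, by omega⟩
  · refine or_iff_not_imp_left.2 fun hn => ?_
    obtain ⟨rfl, -⟩ := not_not.1 hn
    exact ⟨(c i, c (i + 1)), hc.next i hj, hmem i hi, hmem _ hj⟩
  · refine or_iff_not_imp_left.2 fun hn => ?_
    exact ⟨(c i, c j), hc.nest i j (not_not.1 hn), hmem i hi, hmem _ hj⟩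
  · refine or_iff_not_imp_left.2 fun hn => ⟨_, hc.noRet i hi fun j hj => ?_, hmem i hi⟩
    exact hn ⟨j, hj.lt_length, hj⟩
  · refine or_iff_not_imp_left.2 fun hn => ⟨_, hc.noCall i hi fun j hj => ?_, hmem i hi⟩
    exact hn ⟨j, hj.lt.trans hi, hj⟩

lemma exists_valid_of_encodes {T : TilingSystem A C} {h : CRAlphabet K A} {w : List A}
    (hw : w ≠ []) {e : C → ℕ} {X : ℕ → Set ℕ} (hX : T.Encodes h w e X) :
    ∃ c, T.Valid h w c := by
  have hex : ∀ i, ∃ c : C, i < w.length → i ∈ X (e c) := by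
    intro i
    by_cases hi : i < w.length
    · obtain ⟨p, -, -, hp⟩ := hX.letter i hi
      exact ⟨p.2, fun _ => hp⟩
    · obtain ⟨p, -⟩ := hX.letter 0 (List.length_pos_iff.2 hw)
      exact ⟨p.2, fun hi' => absurd hi' hi⟩
  choose c hc using hex
  have hu : ∀ i < w.length, ∀ t, i ∈ X (e t) → t = c i := fun i hi t ht => by
    by_contra hne
    exact hX.unique i hi ⟨(t, c i), hne, ht, hc i hi⟩
  refine ⟨c, fun i a ha => ?_, fun hi => ?_, fun i hi => ?_, fun i hi => ?_, fun i j hm => ?_,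
    fun i hi hn => ?_, fun i hi hn => ?_⟩
  · have hi : i < w.length := (List.getElem?_eq_some_iff.1 ha).1
    obtain ⟨p, h1, h2, h3⟩ := hX.letter i hi
    rw [ha] at h2; cases h2
    rwa [← hu i hi _ h3]
  · rcases hX.init 0 hi with ⟨j, -, h1, -⟩ | ⟨t, h1, h2⟩
    · omega
    · rwa [← hu 0 hi _ h2]
  · rcases hX.final i (by omega) with ⟨j, -, h1, h2⟩ | ⟨t, h1, h2⟩
    · omega
    · rwa [← hu i (by omega) _ h2]
  · rcases hX.next i (by omega) (i + 1) hi with h1 | ⟨p, h1, h2, h3⟩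
    · exact absurd ⟨rfl, hi⟩ h1
    · rwa [← hu i (by omega) _ h2, ← hu (i + 1) hi _ h3]
  · have hj := hm.lt_length
    have hi := hm.lt.trans hj
    rcases hX.nest i hi j hj with h1 | ⟨p, h1, h2, h3⟩
    · exact absurd hm h1
    · rwa [← hu i hi _ h2, ← hu j hj _ h3]
  · rcases hX.noRet i hi with ⟨j, -, h1⟩ | ⟨t, h1, h2⟩
    · exact absurd h1 (hn j)
    · rwa [← hu i hi _ h2]
  · rcases hX.noCall i hi with ⟨j, -, h1⟩ | ⟨t, h1, h2⟩
    · exact absurd h1 (hn j)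
    · rwa [← hu i hi _ h2]

lemma encodes_nil (T : TilingSystem A C) (h : CRAlphabet K A) (e : C → ℕ) (X : ℕ → Set ℕ) :
    T.Encodes h [] e X := by
  constructor <;> simp

/-- The language of a tiling system is defined by an existential sentence. -/
lemma exists_emso [Finite A] [Finite C] (T : TilingSystem A C) (h : CRAlphabet K A) :
    ∃ φ : MSO A, IsEMSO φ ∧ ∀ w ν μ, Sat h w φ ν μ ↔ (w = [] ∨ ∃ c, T.Valid h w c) := by
  obtain ⟨N, ⟨e⟩⟩ := Finite.exists_equiv_fin C
  obtain ⟨ψ, hψ, hs⟩ := T.foDefinable_encodes h (fun t => (e t : ℕ))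
  refine ⟨ψ.exSets N, isEMSO_exSets hψ N, fun w ν μ => ?_⟩
  rw [sat_exSets]
  constructor
  · rintro ⟨X, -, -, hX⟩
    rw [hs] at hX
    exact or_iff_not_imp_left.2 fun hw => exists_valid_of_encodes hw hX
  · rintro (rfl | ⟨c, hc⟩)
    · refine ⟨fun X => if X < N then ∅ else μ X, fun X hX => by simp [hX],
        fun X hX => by simp [hX], (hs _ _ _).2 (T.encodes_nil h _ _)⟩
    · refine ⟨fun X => if X < N then {i | i < w.length ∧ ∃ t, (e t : ℕ) = X ∧ c i = t} else μ X,
        fun X hX => ?_, fun X hX => by simp [hX], (hs _ _ _).2 (encodes_of_valid hc fun t => ?_)⟩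
      · simp only [hX, if_true]; exact fun i hi => hi.1
      · ext i
        simp [Fin.val_inj]

end TilingSystem

/-- A closed curve through the points `p n` of the line, passing through `m` distinct points.
Its edges are unit steps (`κ = 0`), arcs above the line (`κ = 1`) or arcs below the line
(`κ = -1`); `σ = 1` for edges to the right and `σ = 0` for edges to the left. The edge pattern
has period `l`. -/
structure ArcCurve (m l : ℕ) (p : ℕ → ℕ) (κ σ : ℕ → ℤ) : Prop where
  three_le : 3 ≤ m
  p_add : ∀ n, p (n + m) = p n
  p_inj : ∀ a b, p a = p b → a ≡ b [MOD m]
  κ_cases : ∀ n, κ n = 0 ∨ κ n = 1 ∨ κ n = -1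
  κ_add : ∀ n, κ (n + l) = κ n
  σ_add : ∀ n, σ (n + l) = σ n
  σ_spec : ∀ n, (σ n = 1 ∧ p n < p (n + 1)) ∨ (σ n = 0 ∧ p (n + 1) < p n)
  step : ∀ n, κ n = 0 → p (n + 1) = p n + 1 ∨ p n = p (n + 1) + 1
  arc : ∀ n, κ n = 0 ∨ κ (n + 1) = 0
  not_cross : ∀ a b, κ a ≠ 0 → κ a = κ b →
    ¬ (min (p a) (p (a + 1)) < min (p b) (p (b + 1)) ∧
      min (p b) (p (b + 1)) < max (p a) (p (a + 1)) ∧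
      max (p a) (p (a + 1)) < max (p b) (p (b + 1)))

namespace ArcCurve

variable {m l : ℕ} {p : ℕ → ℕ} {κ σ : ℕ → ℤ}

/-- The signed passage of the edge `a` over the point `x`. -/
def passage (p : ℕ → ℕ) (κ : ℕ → ℤ) (a x : ℕ) : ℤ :=
  κ a * ((if x < p a then 1 else 0) - (if x < p (a + 1) then 1 else 0))

/-- The turning of the curve at the point `p (a + 1)`. -/
def turn (p : ℕ → ℕ) (κ : ℕ → ℤ) (a : ℕ) : ℤ :=
  passage p κ (a + 1) (p a) + passage p κ a (p (a + 2))

lemma shift (hc : ArcCurve m l p κ σ) (s : ℕ) :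
    ArcCurve m l (fun n => p (n + s)) (fun n => κ (n + s)) (fun n => σ (n + s)) where
  three_le := hc.three_le
  p_add n := by have := hc.p_add (n + s); rwa [Nat.add_right_comm] at this
  p_inj a b hab := Nat.ModEq.add_right_cancel' s (hc.p_inj _ _ hab)
  κ_cases n := hc.κ_cases _
  κ_add n := by have := hc.κ_add (n + s); rwa [Nat.add_right_comm] at this
  σ_add n := by have := hc.σ_add (n + s); rwa [Nat.add_right_comm] at this
  σ_spec n := by have := hc.σ_spec (n + s); rwa [Nat.add_right_comm] at this
  step n := by have := hc.step (n + s); rwa [Nat.add_right_comm] at this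
  arc n := by have := hc.arc (n + s); rwa [Nat.add_right_comm] at this
  not_cross a b := by
    have := hc.not_cross (a + s) (b + s)
    rwa [Nat.add_right_comm a, Nat.add_right_comm b] at this

lemma p_ne (hc : ArcCurve m l p κ σ) {a b : ℕ} (hab : a < b) (hb : b < a + m) : p a ≠ p b := by
  intro e
  have h1 := (Nat.modEq_iff_dvd' hab.le).1 (hc.p_inj _ _ e)
  have := Nat.le_of_dvd (by omega) h1
  omega

lemma passage_step {a b : ℕ} (hs : p (a + 1) = p a + 1 ∨ p a = p (a + 1) + 1) (h1 : p a ≠ p b)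
    (h2 : p a ≠ p (b + 1)) (h3 : p (a + 1) ≠ p b) (h4 : p (a + 1) ≠ p (b + 1)) :
    passage p κ b (p (a + 1)) = passage p κ b (p a) := by
  have e1 : p (a + 1) < p b ↔ p a < p b := by omega
  have e2 : p (a + 1) < p (b + 1) ↔ p a < p (b + 1) := by omega
  simp only [passage, e1, e2]

lemma indicator_lt_comm {x y : ℕ} (hxy : x ≠ y) :
    (if y < x then 1 else 0 : ℤ) = 1 - (if x < y then 1 else 0) := by
  split_ifs <;> omega

lemma indicator_lt_of_not_cross {a a' b b' : ℕ} (haa : a ≠ a') (hbb : b ≠ b') (h1 : a ≠ b)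
    (h2 : a ≠ b') (h3 : a' ≠ b) (h4 : a' ≠ b')
    (x1 : ¬ (min a a' < min b b' ∧ min b b' < max a a' ∧ max a a' < max b b'))
    (x2 : ¬ (min b b' < min a a' ∧ min a a' < max b b' ∧ max b b' < max a a')) :
    (if a < b then 1 else 0 : ℤ) - (if a < b' then 1 else 0) =
      (if a' < b then 1 else 0) - (if a' < b' then 1 else 0) := by
  rcases lt_or_gt_of_ne haa with haa | haa <;> rcases lt_or_gt_of_ne hbb with hbb | hbb <;>
    simp only [min_eq_left haa.le, min_eq_right haa.le, max_eq_left haa.le, max_eq_right haa.le,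
      min_eq_left hbb.le, min_eq_right hbb.le, max_eq_left hbb.le, max_eq_right hbb.le] at x1 x2 <;>
    split_ifs <;> omega

/-- Exchange of the order in which the endpoints of two disjoint edges are passed. -/
lemma passage_add (hc : ArcCurve m l p κ σ) {a b : ℕ} (hab : a + 1 < b) (hb : b + 1 < a + m) :
    passage p κ b (p a) + passage p κ a (p (b + 1)) =
      passage p κ a (p b) + passage p κ b (p (a + 1)) := by
  have h1 := hc.p_ne (a := a) (b := b) (by omega) (by omega)
  have h2 := hc.p_ne (a := a) (b := b + 1) (by omega) (by omega)
  have h3 := hc.p_ne (a := a + 1) (b := b) (by omega) (by omega)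
  have h4 := hc.p_ne (a := a + 1) (b := b + 1) (by omega) (by omega)
  by_cases za : κ a = 0
  · rw [passage_step (hc.step a za) h1 h2 h3 h4]
    simp [passage, za]
  by_cases zb : κ b = 0
  · rw [passage_step (hc.step b zb) h1.symm h3.symm h2.symm h4.symm]
    simp [passage, zb]
  have e : κ a = κ b ∨ κ a = - κ b := by
    have := hc.κ_cases a
    have := hc.κ_cases b
    omega
  simp only [passage, indicator_lt_comm h1, indicator_lt_comm h2, indicator_lt_comm h3,
    indicator_lt_comm h4]
  rcases e with e | e
  · have hi := indicator_lt_of_not_cross (hc.p_ne (a := a) (b := a + 1) (by omega) (by omega))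
      (hc.p_ne (a := b) (b := b + 1) (by omega) (by omega)) h1 h2 h3 h4 (hc.not_cross a b za e)
      (hc.not_cross b a zb e.symm)
    rw [e]
    linear_combination (2 * κ b) * hi
  · rw [e]
    ring

lemma turn_cases (hc : ArcCurve m l p κ σ) (a : ℕ) :
    (κ a = 0 ∧ κ (a + 1) = 0 ∧ turn p κ a = 0 ∧ σ a = σ (a + 1)) ∨
    (κ a = 0 ∧ κ (a + 1) ≠ 0 ∧ turn p κ a = κ (a + 1) * (σ a - σ (a + 1))) ∨
    (κ a ≠ 0 ∧ κ (a + 1) = 0 ∧ turn p κ a = κ a * (σ (a + 1) - σ a)) := by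
  have h3 := hc.three_le
  have h1 := hc.p_ne (a := a) (b := a + 2) (by omega) (by omega)
  have ha := hc.σ_spec a
  have hb := hc.σ_spec (a + 1)
  have sa := hc.step a
  have sb := hc.step (a + 1)
  simp only [turn, passage, add_assoc, Nat.reduceAdd] at *
  by_cases za : κ a = 0
  · have sa := sa za
    by_cases zb : κ (a + 1) = 0
    · have sb := sb zb
      exact .inl ⟨za, zb, by simp [za, zb], by omega⟩
    · refine .inr (.inl ⟨za, zb, ?_⟩)
      rw [za, zero_mul, add_zero]
      congr 1
      split_ifs <;> omega
  · have zb := (hc.arc a).resolve_left za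
    have sb := sb zb
    refine .inr (.inr ⟨za, zb, ?_⟩)
    rw [zb, zero_mul, zero_add]
    congr 1
    split_ifs <;> omega

lemma turn_eq (hc : ArcCurve m l p κ σ) (a : ℕ) :
    turn p κ a = (κ (a + 1) - κ a) * (σ a - σ (a + 1)) := by
  rcases hc.turn_cases a with ⟨h1, h2, h3, -⟩ | ⟨h1, -, h3⟩ | ⟨-, h2, h3⟩
  · simp [h1, h2, h3]
  · rw [h3, h1]; ring
  · rw [h3, h2]; ring

lemma turn_emod_two (hc : ArcCurve m l p κ σ) (a : ℕ) :
    ∃ z, turn p κ a = σ (a + 1) - σ a + 2 * z := by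
  have ka := hc.κ_cases a
  have kb := hc.κ_cases (a + 1)
  rcases hc.turn_cases a with ⟨-, -, h3, h4⟩ | ⟨-, h2, h3⟩ | ⟨h1, -, h3⟩
  · exact ⟨0, by rw [h3, h4]; ring⟩
  · rcases kb.resolve_left h2 with e | e <;> rw [h3, e]
    · exact ⟨σ a - σ (a + 1), by ring⟩
    · exact ⟨0, by ring⟩
  · rcases ka.resolve_left h1 with e | e <;> rw [h3, e]
    · exact ⟨0, by ring⟩
    · exact ⟨σ a - σ (a + 1), by ring⟩

lemma turn_add (hc : ArcCurve m l p κ σ) (a : ℕ) : turn p κ (a + l) = turn p κ a := by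
  rw [hc.turn_eq, hc.turn_eq, Nat.add_right_comm, hc.κ_add, hc.κ_add, hc.σ_add, hc.σ_add]

lemma even_sum_turn (hc : ArcCurve m l p κ σ) : Even (∑ a ∈ Finset.range l, turn p κ a) := by
  choose z hz using hc.turn_emod_two
  have h0 : σ l = σ 0 := by simpa using hc.σ_add 0
  have : ∑ a ∈ Finset.range l, turn p κ a = 2 * ∑ a ∈ Finset.range l, z a := by
    rw [Finset.sum_congr rfl fun a _ => hz a, Finset.sum_add_distrib, Finset.sum_range_sub, h0,
      Finset.mul_sum]
    ring
  rw [this]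
  exact even_two_mul _

lemma sum_turn_mul (hc : ArcCurve m l p κ σ) (k : ℕ) :
    ∑ a ∈ Finset.range (k * l), turn p κ a = k * ∑ a ∈ Finset.range l, turn p κ a := by
  have hp : ∀ k a, turn p κ (k * l + a) = turn p κ a := by
    intro k a
    induction k with
    | zero => simp
    | succ k ih => rw [← ih, ← hc.turn_add (k * l + a)]; congr 1; ring
  induction k with
  | zero => simp
  | succ k ih =>
    rw [Nat.succ_mul, Finset.sum_range_add, ih, Finset.sum_congr rfl fun a _ => hp k a]
    push_cast
    ring

lemma passage_eq_zero_of_le {a x : ℕ} (h1 : x < p a) (h2 : x < p (a + 1)) :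
    passage p κ a x = 0 := by
  simp [passage, h1, h2]

/-- The total turning of a closed curve without self-intersections is one full turn. -/
lemma sum_turn_of_min (hc : ArcCurve m l p κ σ) (hκ : κ m = κ 0) (h0 : ∀ a, p 0 ≤ p a) :
    ∑ a ∈ Finset.range m, turn p κ a = 2 ∨ ∑ a ∈ Finset.range m, turn p κ a = -2 := by
  obtain ⟨m, rfl⟩ : ∃ m', m = m' + 3 := ⟨m - 3, by have := hc.three_le; omega⟩
  have hm : p (m + 3) = p 0 := by simpa using hc.p_add 0
  have hm' : p (m + 4) = p 1 := by simpa [add_comm, add_left_comm] using hc.p_add 1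
  have hmin : ∀ a, 0 < a → a < m + 3 → p 0 < p a := fun a h1 h2 =>
    lt_of_le_of_ne (h0 a) (hc.p_ne h1 (by omega))
  set X : ℕ → ℕ → ℤ := fun a b => passage p κ b (p a) with hX
  set Y : ℕ → ℕ → ℤ := fun a b => passage p κ a (p b) with hY
  set C : ℕ → ℤ := fun a => ∑ b ∈ Finset.Ico (a + 1) (m + 2), X a b with hC
  have hdiff : ∀ a ≤ m, C a - C (a + 1) = turn p κ a - Y a (m + 2) := by
    intro a ha
    have e1 : C a = X a (a + 1) + ∑ b ∈ Finset.Ico (a + 2) (m + 2), X a b := by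
      rw [hC]; exact Finset.sum_eq_sum_Ico_succ_bot (by omega) _
    have e2 : ∑ b ∈ Finset.Ico (a + 2) (m + 2), X a b - C (a + 1) =
        ∑ b ∈ Finset.Ico (a + 2) (m + 2), (Y a b - Y a (b + 1)) := by
      rw [hC, ← Finset.sum_sub_distrib]
      refine Finset.sum_congr rfl fun b hb => ?_
      have := Finset.mem_Ico.1 hb
      have := hc.passage_add (a := a) (b := b) (by omega) (by omega)
      simp only [hX, hY]
      linarith
    have e3 : ∑ b ∈ Finset.Ico (a + 2) (m + 2), (Y a b - Y a (b + 1)) =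
        Y a (a + 2) - Y a (m + 2) := by
      have := Finset.sum_Ico_sub (Y a) (show a + 2 ≤ m + 2 by omega)
      rw [← neg_sub (Y a (m + 2)), ← this, ← Finset.sum_neg_distrib]
      exact Finset.sum_congr rfl fun b _ => by ring
    have e4 : turn p κ a = X a (a + 1) + Y a (a + 2) := rfl
    linarith
  have hC0 : C 0 = 0 := Finset.sum_eq_zero fun b hb => by
    have := Finset.mem_Ico.1 hb
    exact passage_eq_zero_of_le (hmin _ (by omega) (by omega)) (hmin _ (by omega) (by omega))
  have hCm : C (m + 1) = 0 := by simp [hC]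
  have hsum : ∑ a ∈ Finset.range (m + 1), turn p κ a =
      ∑ a ∈ Finset.range (m + 1), Y a (m + 2) := by
    have := Finset.sum_range_sub' C (m + 1)
    rw [hC0, hCm, Finset.sum_congr rfl fun a ha => hdiff a (by
      have := Finset.mem_range.1 ha; omega), Finset.sum_sub_distrib] at this
    linarith
  have hYX : ∑ a ∈ Finset.range m, Y (a + 1) (m + 2) = X 1 (m + 2) - X (m + 1) (m + 2) := by
    rw [← Finset.sum_range_sub' (fun a => X (a + 1) (m + 2))]
    refine Finset.sum_congr rfl fun a ha => ?_
    have := Finset.mem_range.1 ha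
    have h1 := hc.passage_add (a := a + 1) (b := m + 2) (by omega) (by omega)
    have h2 : passage p κ (a + 1) (p (m + 2 + 1)) = 0 := by
      rw [show m + 2 + 1 = m + 3 from rfl, hm]
      exact passage_eq_zero_of_le (hmin _ (by omega) (by omega)) (hmin _ (by omega) (by omega))
    simp only [hX, hY]
    linarith
  have ht1 : turn p κ (m + 1) = X (m + 1) (m + 2) := by
    have h2 : passage p κ (m + 1) (p (m + 3)) = 0 := by
      rw [hm]
      exact passage_eq_zero_of_le (hmin _ (by omega) (by omega)) (hmin _ (by omega) (by omega))
    simp [turn, hX, h2, show m + 1 + 2 = m + 3 from rfl]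
  have ht2 : turn p κ (m + 2) = Y 0 (m + 2) + X 1 (m + 2) := by
    have h1 : passage p κ (m + 3) (p (m + 2)) = passage p κ 0 (p (m + 2)) := by
      simp only [passage, hκ, hm, show m + 3 + 1 = m + 4 from rfl, hm', zero_add]
    simp only [turn, hX, hY, show m + 2 + 2 = m + 4 from rfl, show m + 2 + 1 = m + 3 from rfl,
      hm', h1]
  have htot : ∑ a ∈ Finset.range (m + 3), turn p κ a = 2 * (Y 0 (m + 2) + X 1 (m + 2)) := by
    rw [Finset.sum_range_succ, Finset.sum_range_succ, hsum, Finset.sum_range_succ', hYX, ht1, ht2]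
    ring
  have hends : Y 0 (m + 2) + X 1 (m + 2) = 1 ∨ Y 0 (m + 2) + X 1 (m + 2) = -1 := by
    have n1 := hmin 1 (by omega) (by omega)
    have n2 := hmin (m + 2) (by omega) (by omega)
    have n3 := hc.p_ne (a := 1) (b := m + 2) (by omega) (by omega)
    have s0 : κ 0 = 0 → p 1 = p 0 + 1 ∨ p 0 = p 1 + 1 := hc.step 0
    have s1 := hc.step (m + 2)
    have ar := hc.arc (m + 2)
    rw [show m + 2 + 1 = m + 3 from rfl] at s1 ar
    rw [hm] at s1
    rw [hκ] at ar
    simp only [hX, hY, passage, show m + 2 + 1 = m + 3 from rfl, zero_add, hm]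
    have k0 := hc.κ_cases 0
    have k1 := hc.κ_cases (m + 2)
    by_cases z0 : κ 0 = 0
    · have s0 := s0 z0
      have z1 : κ (m + 2) ≠ 0 := fun z1 => by have := s1 z1; omega
      rw [z0, zero_mul, zero_add, if_pos (by omega), if_neg (by omega)]
      omega
    · have z1 := ar.resolve_right z0
      have s1 := s1 z1
      rw [z1, zero_mul, add_zero, if_neg (by omega), if_pos (by omega)]
      omega
  rw [htot]
  omega

/-- The edge pattern of a closed curve without self-intersections is traversed exactly once. -/
theorem eq_one_of_mul {k : ℕ} (hc : ArcCurve m l p κ σ) (hm : m = k * l) : k = 1 := by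
  obtain ⟨s, hs⟩ : ∃ s, ∀ a, p s ≤ p a := by
    obtain ⟨s, hs⟩ := exists_minimal_of_wellFoundedLT (· ∈ Set.range p) ⟨_, 0, rfl⟩
    obtain ⟨s, rfl⟩ := hs.1
    exact ⟨s, fun a => not_lt.1 fun h => absurd (hs.2 ⟨a, rfl⟩ h.le) (not_le.2 h)⟩
  have hc' := hc.shift s
  have hκ : ∀ n, κ (k * l + n) = κ n := by
    intro n
    clear hm
    induction k with
    | zero => simp
    | succ k ih => rw [← ih, ← hc.κ_add (k * l + n)]; congr 1; ring
  have hsum := hc'.sum_turn_of_min (by simp [hm, hκ]) (by simpa using fun a => hs (a + s))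
  rw [hm, hc'.sum_turn_mul] at hsum
  obtain ⟨z, hz⟩ := hc'.even_sum_turn
  rw [hz] at hsum
  have hk : (k : ℤ) ∣ 1 := by
    rcases hsum with h | h
    · exact ⟨z, by linarith⟩
    · exact ⟨-z, by linarith⟩
  exact_mod_cast Int.natAbs_dvd_natAbs.2 hk |> Nat.dvd_one.1

end ArcCurve

section Walks

variable {K : ℕ} {A : Type}

/-- The edges of a nested word: successor edges (`false`) and matching edges (`true`). -/
def Edge (h : CRAlphabet K A) (w : List A) : Bool → ℕ → ℕ → Prop
  | false, i, j => j = i + 1 ∧ j < w.length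
  | true, i, j => MuAny h w i j

/-- `Arrow h w (b, f) i j`: one moves from `i` to `j` along an edge of type `b`, forwards if `f`
and backwards otherwise. -/
def Arrow (h : CRAlphabet K A) (w : List A) (d : Bool × Bool) (i j : ℕ) : Prop :=
  if d.2 then Edge h w d.1 i j else Edge h w d.1 j i

variable {h : CRAlphabet K A} {w : List A}

lemma Edge.lt {b : Bool} {i j : ℕ} (he : Edge h w b i j) : i < j := by
  cases b
  · have := he.1; omega
  · exact MuAny.lt he

lemma Edge.lt_length {b : Bool} {i j : ℕ} (he : Edge h w b i j) : j < w.length := by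
  cases b
  · exact he.2
  · exact MuAny.lt_length he

lemma Edge.right_unique {b : Bool} {i j j' : ℕ} (he : Edge h w b i j) (he' : Edge h w b i j') :
    j = j' := by
  cases b
  · exact he.1.trans he'.1.symm
  · exact MuAny.right_unique he he'

lemma Edge.left_unique {b : Bool} {i i' j : ℕ} (he : Edge h w b i j) (he' : Edge h w b i' j) :
    i = i' := by
  cases b
  · exact Nat.succ_injective (he.1.symm.trans he'.1)
  · exact MuAny.left_unique he he'

namespace Arrow

variable {d : Bool × Bool} {i j j' : ℕ}

lemma unique (ha : Arrow h w d i j) (ha' : Arrow h w d i j') : j = j' := by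
  obtain ⟨b, _ | _⟩ := d
  · exact Edge.left_unique ha ha'
  · exact Edge.right_unique ha ha'

lemma lt_length (ha : Arrow h w d i j) : i < w.length ∧ j < w.length := by
  obtain ⟨b, _ | _⟩ := d
  · exact ⟨Edge.lt_length ha, (Edge.lt ha).trans (Edge.lt_length ha)⟩
  · exact ⟨(Edge.lt ha).trans (Edge.lt_length ha), Edge.lt_length ha⟩

end Arrow

/-- The opposite direction. -/
def opp (d : Bool × Bool) : Bool × Bool := (d.1, !d.2)

lemma arrow_opp {d : Bool × Bool} {i j : ℕ} : Arrow h w (opp d) j i ↔ Arrow h w d i j := by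
  obtain ⟨b, _ | _⟩ := d <;> rfl

open Classical in
/-- The position reached from `i` by one move in direction `d`. -/
noncomputable def move (h : CRAlphabet K A) (w : List A) (d : Bool × Bool) (i : ℕ) : Option ℕ :=
  if hj : ∃ j, Arrow h w d i j then some hj.choose else none

lemma move_eq_some {d : Bool × Bool} {i j : ℕ} : move h w d i = some j ↔ Arrow h w d i j := by
  unfold move
  split_ifs with hj
  · rw [Option.some_inj]
    exact ⟨fun e => e ▸ hj.choose_spec, fun ha => hj.choose_spec.unique ha⟩
  · simp only [false_iff]
    exact fun ha => hj ⟨j, ha⟩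

lemma move_eq_none {d : Bool × Bool} {i : ℕ} : move h w d i = none ↔ ∀ j, ¬ Arrow h w d i j := by
  simp [Option.eq_none_iff_forall_ne_some, move_eq_some]

/-- The position reached from `i` by following the directions in `u`. -/
noncomputable def walk (h : CRAlphabet K A) (w : List A) : List (Bool × Bool) → ℕ → Option ℕ
  | [], i => some i
  | d :: u, i => (move h w d i).bind (walk h w u)

lemma walk_cons_eq_some {d : Bool × Bool} {u : List (Bool × Bool)} {i j : ℕ} :
    walk h w (d :: u) i = some j ↔ ∃ k, Arrow h w d i k ∧ walk h w u k = some j := by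
  simp [walk, Option.bind_eq_some_iff, move_eq_some]

lemma walk_append (u v : List (Bool × Bool)) (i : ℕ) :
    walk h w (u ++ v) i = (walk h w u i).bind (walk h w v) := by
  induction u generalizing i with
  | nil => rfl
  | cons d u ih =>
    simp only [List.cons_append, walk, Option.bind_assoc]
    congr 1
    exact funext ih

/-- The walk `u` backwards. -/
def revWalk (u : List (Bool × Bool)) : List (Bool × Bool) := (u.map opp).reverse

@[simp] lemma length_revWalk (u : List (Bool × Bool)) : (revWalk u).length = u.length := by
  simp [revWalk]

@[simp] lemma revWalk_revWalk (u : List (Bool × Bool)) : revWalk (revWalk u) = u := by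
  have : opp ∘ opp = id := by ext d <;> simp [opp]
  simp [revWalk, this]

lemma walk_revWalk {u : List (Bool × Bool)} {i j : ℕ} (hu : walk h w u i = some j) :
    walk h w (revWalk u) j = some i := by
  induction u generalizing i with
  | nil =>
    rw [walk, Option.some_inj] at hu
    rw [hu]; rfl
  | cons d u ih =>
    obtain ⟨k, hk, hu⟩ := walk_cons_eq_some.1 hu
    rw [revWalk, List.map_cons, List.reverse_cons, walk_append, ← revWalk, ih hu,
      Option.bind_some, walk_cons_eq_some]
    exact ⟨i, arrow_opp.2 hk, rfl⟩

lemma lt_length_of_walk {u : List (Bool × Bool)} {i j : ℕ} (hi : i < w.length)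
    (hu : walk h w u i = some j) : j < w.length := by
  induction u generalizing i with
  | nil =>
    rw [walk, Option.some_inj] at hu
    exact hu ▸ hi
  | cons d u ih =>
    obtain ⟨k, hk, hu⟩ := walk_cons_eq_some.1 hu
    exact ih hk.lt_length.2 hu

/-- Distinct positions at distance at most `R` carry distinct labels. -/
def Separated {Λ : Type*} (h : CRAlphabet K A) (w : List A) (R : ℕ) (lab : ℕ → Λ) : Prop :=
  ∀ u i j, u.length ≤ R → walk h w u i = some j → lab i = lab j → i = j

end Walks

section Local

variable {A : Type}

lemma walk_map_range' {K : ℕ} {h : CRAlphabet K A} {w : List A} {d : ℕ → Bool × Bool} {q : ℕ → ℕ}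
    {c a : ℕ} (hq : ∀ n < a + c, Arrow h w (d n) (q n) (q (n + 1))) :
    walk h w ((List.range' a c).map d) (q a) = some (q (a + c)) := by
  induction c generalizing a with
  | zero => rfl
  | succ c ih =>
    rw [List.range'_succ, List.map_cons, walk_cons_eq_some]
    refine ⟨q (a + 1), hq a (by omega), ?_⟩
    rw [ih fun n hn => hq n (by omega)]
    congr 2
    omega

lemma exists_path_of_walk {K : ℕ} {h : CRAlphabet K A} {w : List A} {u : List (Bool × Bool)}
    {d : ℕ → Bool × Bool} {i j : ℕ} (hd : ∀ n (hn : n < u.length), d n = u[n])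
    (hu : walk h w u i = some j) :
    ∃ q : ℕ → ℕ, q 0 = i ∧ q u.length = j ∧ ∀ n < u.length, Arrow h w (d n) (q n) (q (n + 1)) := by
  induction u generalizing i d with
  | nil =>
    rw [walk, Option.some_inj] at hu
    exact ⟨fun _ => i, rfl, hu, by simp⟩
  | cons e u ih =>
    obtain ⟨k, hk, hu⟩ := walk_cons_eq_some.1 hu
    obtain ⟨q, hq0, hql, hq⟩ := ih (d := fun n => d (n + 1))
      (fun n hn => hd (n + 1) (by simpa using hn)) hu
    refine ⟨fun n => if n = 0 then i else q (n - 1), by simp, by simpa using hql, ?_⟩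
    intro n hn
    cases n with
    | zero => simpa [hd 0 (by simp), hq0] using hk
    | succ n => simpa using hq n (by simpa using hn)

/-- Endless repetition of a walk whose ends carry equal labels, when equally labelled nearby
positions have equally labelled neighbours. -/
lemma exists_periodic_path {K : ℕ} {h : CRAlphabet K A} {w : List A} {Λ : Type*} {lab : ℕ → Λ}
    {u : List (Bool × Bool)} {d : ℕ → Bool × Bool} {i j : ℕ}
    (hlen : 0 < u.length) (hd : ∀ n (hn : n < u.length), d n = u[n])
    (hper : ∀ n, d (n + u.length) = d n) (hu : walk h w u i = some j) (hij : lab i = lab j)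
    (hloc : ∀ v x y, v.length = u.length → walk h w v x = some y → lab x = lab y →
      ∀ e, (move h w e x).map lab = (move h w e y).map lab) :
    ∃ q : ℕ → ℕ, q 0 = i ∧ q u.length = j ∧ (∀ n, Arrow h w (d n) (q n) (q (n + 1))) ∧
      ∀ n, lab (q (n + u.length)) = lab (q n) := by
  obtain ⟨q₀, hq0, hql, hq⟩ := exists_path_of_walk hd hu
  let q : ℕ → ℕ := fun n => n.rec i fun n x => (move h w (d n) x).getD 0
  have hq' : ∀ n ≤ u.length, q n = q₀ n := by
    intro n hn
    induction n with
    | zero => exact hq0.symm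
    | succ n ih =>
      change (move h w (d n) (q n)).getD 0 = _
      rw [ih (by omega), move_eq_some.2 (hq n (by omega)), Option.getD_some]
  have key : ∀ n, (∀ a < n + u.length, Arrow h w (d a) (q a) (q (a + 1))) ∧
      lab (q (n + u.length)) = lab (q n) := by
    intro n
    induction n with
    | zero =>
      rw [zero_add]
      refine ⟨fun a ha => ?_, ?_⟩
      · rw [hq' a ha.le, hq' (a + 1) ha]
        exact hq a ha
      · rw [hq' _ le_rfl, hql]
        exact hij.symm
    | succ n ih =>
      obtain ⟨h1, h2⟩ := ih
      have h3 := hloc _ _ _ (by simp) (walk_map_range' h1) h2.symm (d n)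
      rw [move_eq_some.2 (h1 n (by omega)), Option.map_some, eq_comm, Option.map_eq_some_iff] at h3
      obtain ⟨y, hy, hlab⟩ := h3
      have e : q (n + u.length + 1) = y := by
        change (move h w (d (n + u.length)) (q (n + u.length))).getD 0 = y
        rw [hper, hy, Option.getD_some]
      rw [Nat.add_right_comm]
      refine ⟨fun a ha => ?_, by rw [e, hlab]⟩
      rcases Nat.lt_succ_iff_lt_or_eq.1 ha with ha | rfl
      · exact h1 a ha
      · rw [e, hper]
        exact move_eq_some.1 hy
  refine ⟨q, rfl, by rw [hq' _ le_rfl, hql], fun n => (key (n + 1)).1 n (by omega), ?_⟩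
  exact fun n => (key n).2

/-- A periodic path without shortcuts is closed up by finiteness, and is then an arc curve. -/
lemma false_of_periodic_path {h : CRAlphabet 2 A} {w : List A} {Λ : Type*} {lab : ℕ → Λ}
    {d : ℕ → Bool × Bool} {q : ℕ → ℕ} {l : ℕ} (hl : 0 < l)
    (hlet : ∀ i < w.length, ∀ j < w.length, lab i = lab j → w[i]? = w[j]?)
    (hper : ∀ n, d (n + l) = d n) (hq : ∀ n, Arrow h w (d n) (q n) (q (n + 1)))
    (hlab : ∀ n, lab (q (n + l)) = lab (q n))
    (hinj : ∀ a < l, ∀ b < l, lab (q a) = lab (q b) → a = b) (hne : q l ≠ q 0) : False := by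
  have hlen : ∀ n, q n < w.length := fun n => (hq n).lt_length.1
  have hmod : ∀ n, lab (q n) = lab (q (n % l)) := fun n => by
    conv_lhs => rw [← Nat.mod_add_div' n l]
    generalize n % l = r
    induction n / l with
    | zero => simp
    | succ k ih => rw [← ih, ← hlab (r + k * l)]; congr 2; ring
  have hdmod : ∀ n k, d (n + k * l) = d n := fun n k => by
    induction k with
    | zero => simp
    | succ k ih => rw [← ih, ← hper (n + k * l)]; congr 1; ring
  have hcong : ∀ a b, lab (q a) = lab (q b) → a ≡ b [MOD l] := fun a b hab =>
    hinj _ (Nat.mod_lt _ hl) _ (Nat.mod_lt _ hl) (by rw [← hmod, ← hmod, hab])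
  have hdcong : ∀ a b, a ≡ b [MOD l] → d a = d b := by
    intro a b hab
    rw [← Nat.mod_add_div' a l, ← Nat.mod_add_div' b l, hdmod, hdmod, hab]
  have hback : ∀ a c, q a = q (a + c) → q 0 = q c := by
    intro a c
    induction a with
    | zero => simp
    | succ a ih =>
      intro e
      apply ih
      have h1 : a ≡ a + c [MOD l] := by
        have := hcong _ _ (congrArg lab e)
        rw [Nat.add_right_comm] at this
        exact Nat.ModEq.add_right_cancel' 1 this
      have h2 := arrow_opp.2 (hq a)
      have h3 := arrow_opp.2 (hq (a + c))
      rw [Nat.add_right_comm] at e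
      rw [← hdcong _ _ h1, ← e] at h3
      exact h2.unique h3
  have hex : ∃ m, 0 < m ∧ q m = q 0 := by
    obtain ⟨a, b, hab, e⟩ := Finite.exists_ne_map_eq_of_infinite
      (fun n => (⟨q n, hlen n⟩ : Fin w.length))
    have e : q a = q b := congrArg Fin.val e
    rcases lt_or_gt_of_ne hab with hab | hab
    · exact ⟨b - a, by omega, (hback a (b - a) (by rw [e]; congr 1; omega)).symm⟩
    · exact ⟨a - b, by omega, (hback b (a - b) (by rw [← e]; congr 1; omega)).symm⟩
  classical
  obtain ⟨m, ⟨hm, hqm⟩, hmin⟩ : ∃ m, (0 < m ∧ q m = q 0) ∧ ∀ n, 0 < n → q n = q 0 → m ≤ n :=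
    ⟨Nat.find hex, Nat.find_spec hex, fun n h1 h2 => Nat.find_le ⟨h1, h2⟩⟩
  obtain ⟨k, hk⟩ : l ∣ m := (Nat.modEq_zero_iff_dvd).1 (hcong _ _ (congrArg lab hqm))
  have hk1 : k ≠ 1 := by
    rintro rfl
    rw [hk, mul_one] at hqm
    exact hne hqm
  have hk0 : k ≠ 0 := by
    rintro rfl
    omega
  have hqadd : ∀ n, q (n + m) = q n := by
    intro n
    induction n with
    | zero => simpa using hqm
    | succ n ih =>
      have h1 := hq (n + m)
      rw [ih, hk, mul_comm, hdmod, ← mul_comm, ← hk, Nat.add_right_comm] at h1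
      exact h1.unique (hq n)
  have hqmod : ∀ n, q n = q (n % m) := fun n => by
    conv_lhs => rw [← Nat.mod_add_div' n m]
    generalize n % m = r
    induction n / m with
    | zero => simp
    | succ k ih => rw [← ih, ← hqadd (r + k * m)]; congr 1; ring
  have hqinj' : ∀ a b, a ≤ b → q a = q b → a ≡ b [MOD m] := by
    intro a b hab e
    rw [Nat.modEq_iff_dvd' hab]
    have h1 := hback a (b - a) (by rw [e]; congr 1; omega)
    rw [hqmod (b - a)] at h1
    by_contra hnd
    have := hmin _ (Nat.pos_of_ne_zero fun e => hnd (Nat.dvd_of_mod_eq_zero e)) h1.symm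
    exact absurd (Nat.mod_lt (b - a) hm) (by omega)
  have hqinj : ∀ a b, q a = q b → a ≡ b [MOD m] := by
    intro a b e
    rcases le_total a b with hab | hab
    · exact hqinj' a b hab e
    · exact (hqinj' b a hab e.symm).symm
  have hdir : ∀ n, if (d n).2 then q n < q (n + 1) else q (n + 1) < q n := by
    intro n
    have := hq n
    rw [Arrow] at this
    split_ifs at this ⊢ <;> exact this.lt
  have hl1 : l ≠ 1 := by
    rintro rfl
    have hd : ∀ n, d n = d 0 := fun n => hdcong _ _ (Nat.modEq_one)
    replace hdir : ∀ n, if (d 0).2 then q n < q (n + 1) else q (n + 1) < q n := fun n => by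
      have := hdir n
      rwa [hd n] at this
    split_ifs at hdir
    · exact absurd (strictMono_nat_of_lt_succ hdir hm) (by rw [hqm]; exact lt_irrefl _)
    · exact absurd (strictAnti_nat_of_succ_lt hdir hm) (by rw [hqm]; exact lt_irrefl _)
  have hm3 : 3 ≤ m := by
    have := Nat.mul_le_mul (show 2 ≤ l by omega) (show 2 ≤ k by omega)
    omega
  let above : ℕ → Prop := fun n =>
    ∃ a, w[min (q n) (q (n + 1))]? = some a ∧ h.kind a = .call 0
  have hmatch : ∀ n, (d n).1 = true →
      ∃ s, Matched h w s (min (q n) (q (n + 1))) (max (q n) (q (n + 1))) := by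
    intro n hn
    have h1 := hq n
    have h2 := hdir n
    rw [Arrow, hn] at h1
    split_ifs at h1 h2
    · rw [min_eq_left h2.le, max_eq_right h2.le]; exact h1
    · rw [min_eq_right h2.le, max_eq_left h2.le]; exact h1
  have habove : ∀ n, (d n).1 = true → ∃ s,
      Matched h w s (min (q n) (q (n + 1))) (max (q n) (q (n + 1))) ∧ (above n ↔ s = 0) := by
    intro n hn
    obtain ⟨s, hs⟩ := hmatch n hn
    obtain ⟨a, ha, hka⟩ := hs.exists_call
    refine ⟨s, hs, ?_⟩
    simp only [above, ha, Option.some_inj, exists_eq_left', hka, CRKind.call.injEq]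
  let κ : ℕ → ℤ := fun n => if (d n).1 then (if above n then 1 else -1) else 0
  have hκ : ∀ n, κ n = 0 ↔ (d n).1 = false := by
    intro n
    simp only [κ]
    by_cases hd1 : (d n).1
    · by_cases xa : above n <;> simp [hd1, xa]
    · simp [hd1]
  have hc : ArcCurve m l q κ (fun n => if (d n).2 then 1 else 0) := by
    refine ⟨hm3, hqadd, hqinj, fun n => ?_, fun n => ?_, fun n => ?_, fun n => ?_, fun n hn => ?_,
      fun n => ?_, fun a b ha hab => ?_⟩
    · simp only [κ]
      split_ifs <;> simp
    · have h1 : w[min (q (n + l)) (q (n + l + 1))]? = w[min (q n) (q (n + 1))]? := by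
        have h1 := hdir n
        have h2 := hdir (n + l)
        rw [hper] at h2
        have h3 := hlab (n + 1)
        rw [Nat.add_right_comm] at h3
        split_ifs at h1 h2
        · rw [min_eq_left h1.le, min_eq_left h2.le]
          exact hlet _ (hlen _) _ (hlen _) (hlab n)
        · rw [min_eq_right h1.le, min_eq_right h2.le]
          exact hlet _ (hlen _) _ (hlen _) h3
      simp only [κ, above, hper, h1]
    · simp only [hper n]
    · have := hdir n
      split_ifs at this ⊢ <;> simp [this]
    · have h1 := hq n
      rw [Arrow, (hκ n).1 hn] at h1
      split_ifs at h1
      · exact .inl h1.1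
      · exact .inr h1.1
    · by_contra! hcon
      have e1 : (d n).1 = true := by simpa [hκ] using hcon.1
      have e2 : (d (n + 1)).1 = true := by simpa [hκ] using hcon.2
      have hne : q n ≠ q (n + 2) := fun e => by
        have := (Nat.modEq_iff_dvd' (by omega)).1 (hqinj _ _ e)
        have := Nat.le_of_dvd (by omega) this
        omega
      have h1 := hq n
      have h2 := hq (n + 1)
      rw [Arrow, e1] at h1
      rw [Arrow, e2] at h2
      split_ifs at h1 h2
      · exact MuAny.ret_ne_call h1 h2
      · exact hne (MuAny.left_unique h1 h2)
      · exact hne (MuAny.right_unique h1 h2)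
      · exact MuAny.ret_ne_call h2 h1
    · have e1 : (d a).1 = true := by simpa [hκ] using ha
      have e2 : (d b).1 = true := by rw [hab] at ha; simpa [hκ] using ha
      obtain ⟨s, hs, hsa⟩ := habove a e1
      obtain ⟨t, ht, htb⟩ := habove b e2
      have hst : s = t := by
        have : s = 0 ↔ t = 0 := by
          rw [← hsa, ← htb]
          simp only [κ, e1, e2, if_true] at hab
          by_cases xa : above a <;> by_cases xb : above b
          · exact iff_of_true xa xb
          · rw [if_pos xa, if_neg xb] at hab; omega
          · rw [if_neg xa, if_pos xb] at hab; omega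
          · exact iff_of_false xa xb
        omega
      subst hst
      exact hs.not_cross ht
  exact hk1 (hc.eq_one_of_mul (by rw [hk, mul_comm]))

/-- If equally labelled nearby positions have equally labelled neighbours, then nearby positions
are never equally labelled. -/
theorem separated_of_local {h : CRAlphabet 2 A} {w : List A} {Λ : Type*} {lab : ℕ → Λ} {R : ℕ}
    (hlet : ∀ i < w.length, ∀ j < w.length, lab i = lab j → w[i]? = w[j]?)
    (hloc : ∀ v x y, v.length ≤ R → walk h w v x = some y → lab x = lab y →
      ∀ e, (move h w e x).map lab = (move h w e y).map lab) : Separated h w R lab := by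
  intro u
  induction hn : u.length using Nat.strong_induction_on generalizing u with
  | _ n ih =>
    subst hn
    intro i j hR hu hij
    by_contra hne
    have hlen : 0 < u.length := by
      rcases u with _ | _
      · exact absurd (Option.some_inj.1 hu) hne
      · simp
    let d : ℕ → Bool × Bool := fun n => u[n % u.length]'(Nat.mod_lt _ hlen)
    have hd : ∀ n (hn : n < u.length), d n = u[n] := fun n hn => by
      simp only [d, Nat.mod_eq_of_lt hn]
    have hper : ∀ n, d (n + u.length) = d n := fun n => by simp only [d, Nat.add_mod_right]
    obtain ⟨q, hq0, hql, hq, hlab⟩ := exists_periodic_path hlen hd hper hu hij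
      fun v x y hv => hloc v x y (hv.trans_le hR)
    refine false_of_periodic_path hlen hlet hper hq hlab ?_ (by rw [hq0, hql]; exact Ne.symm hne)
    have hlt : ∀ a b, a < b → b < u.length → lab (q a) ≠ lab (q b) := by
      intro a b hab hb e
      have h1 := walk_map_range' (c := b - a) (a := a) fun n _ => hq n
      rw [show a + (b - a) = b by omega] at h1
      have h2 := ih (b - a) (by omega) _ (by simp) (q a) (q b) (by omega) h1 e
      have h3 := walk_map_range' (c := a) (a := 0) fun n _ => hq n
      have h4 := walk_map_range' (c := u.length - b) (a := b) fun n _ => hq n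
      rw [show b + (u.length - b) = u.length by omega, hql] at h4
      rw [zero_add, hq0] at h3
      refine hne (ih (a + (u.length - b)) (by omega)
        ((List.range' 0 a).map d ++ (List.range' b (u.length - b)).map d) (by simp) i j
        (by omega) ?_ hij)
      rw [walk_append, h3, Option.bind_some, h2, h4]
    intro a ha b hb e
    rcases lt_trichotomy a b with hab | hab | hab
    · exact absurd e (hlt a b hab hb)
    · exact hab
    · exact absurd e.symm (hlt b a hab ha)

end Local

instance finite_walks (R : ℕ) : Finite {u : List (Bool × Bool) // u.length ≤ R} :=
  (List.finite_length_le _ R).to_subtype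

section Colouring

variable {K : ℕ} {A : Type}

/-- Greedy colouring of the positions so that nearby positions get distinct colours. -/
lemma exists_separated_colouring (h : CRAlphabet K A) (w : List A) (R : ℕ) :
    ∃ χ : ℕ → Fin (Nat.card {u : List (Bool × Bool) // u.length ≤ R} + 1),
      Separated h w R χ := by
  have key : ∀ n, ∃ χ : ℕ → Fin (Nat.card {u : List (Bool × Bool) // u.length ≤ R} + 1),
      ∀ i < n, ∀ j < n, ∀ u : List (Bool × Bool), u.length ≤ R → walk h w u i = some j →
        χ i = χ j → i = j := by
    intro n
    induction n with
    | zero => exact ⟨fun _ => 0, by simp⟩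
    | succ n ih =>
      obtain ⟨χ, hχ⟩ := ih
      obtain ⟨c, hc⟩ : ∃ c, ∀ u : List (Bool × Bool), u.length ≤ R → ∀ j,
          walk h w u n = some j → χ j ≠ c := by
        by_contra! hcon
        choose u hu j hj hχj using hcon
        have hinj : Function.Injective fun c =>
            (⟨u c, hu c⟩ : {u : List (Bool × Bool) // u.length ≤ R}) := by
          intro c c' e
          have e := congrArg Subtype.val e
          simp only at e
          have h1 := hj c
          rw [e, hj c', Option.some_inj] at h1
          rw [← hχj c, ← hχj c', h1]
        have := Nat.card_le_card_of_injective _ hinj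
        simp at this
      refine ⟨Function.update χ n c, fun i hi j hj u hu hij he => ?_⟩
      rcases Nat.lt_succ_iff_lt_or_eq.1 hi with hi | rfl <;>
        rcases Nat.lt_succ_iff_lt_or_eq.1 hj with hj | rfl
      · rw [Function.update_of_ne hi.ne, Function.update_of_ne hj.ne] at he
        exact hχ i hi j hj u hu hij he
      · rw [Function.update_of_ne hi.ne, Function.update_self] at he
        exact absurd he (hc _ (by simpa using hu) _ (walk_revWalk hij))
      · rw [Function.update_of_ne hj.ne, Function.update_self] at he
        exact absurd he.symm (hc _ hu _ hij)
      · rfl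
  obtain ⟨χ, hχ⟩ := key w.length
  refine ⟨χ, fun u i j hu hij he => ?_⟩
  rcases u with _ | ⟨d, u⟩
  · exact Option.some_inj.1 hij
  · obtain ⟨k, hk, -⟩ := walk_cons_eq_some.1 hij
    exact hχ i hk.lt_length.1 j (lt_length_of_walk hk.lt_length.1 hij) _ hu hij he

end Colouring

section Views

variable {K : ℕ} {A Λ : Type} {h : CRAlphabet K A} {w w' : List A} {lab lab' : ℕ → Λ}
  {μv μv' : ℕ → Set ℕ} {ν ν' : ℕ → ℕ} {R N B : ℕ}

/-- The labels seen from `i` at the ends of the walks of length at most `r`. -/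
noncomputable def view (h : CRAlphabet K A) (w : List A) (lab : ℕ → Λ) (r i : ℕ)
    (u : List (Bool × Bool)) : Option Λ :=
  if u.length ≤ r then (walk h w u i).map lab else none

/-- The number of positions with a given view. -/
noncomputable def viewCount (h : CRAlphabet K A) (w : List A) (lab : ℕ → Λ) (r : ℕ)
    (t : List (Bool × Bool) → Option Λ) : ℕ :=
  {i | i < w.length ∧ view h w lab r i = t}.ncard

/-- The labels determine the letters and the sets containing a position. -/
def LabelsDetermine (w w' : List A) (lab lab' : ℕ → Λ) (μv μv' : ℕ → Set ℕ) : Prop :=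
  ∀ i < w.length, ∀ j < w'.length, lab i = lab' j →
    w[i]? = w'[j]? ∧ ∀ X, i ∈ μv X ↔ j ∈ μv' X

/-- Views of radius at most `R` occur equally often, up to the threshold `N`. -/
def SameCounts (h : CRAlphabet K A) (R N : ℕ) (w w' : List A) (lab lab' : ℕ → Λ) : Prop :=
  ∀ r ≤ R, ∀ t, ∀ k ≤ N, k ≤ viewCount h w lab r t ↔ k ≤ viewCount h w' lab' r t

/-- The invariant of the Ehrenfeucht–Fraïssé game behind Hanf's theorem. -/
structure PointedSimilar (h : CRAlphabet K A) (R N B : ℕ) (w w' : List A) (lab lab' : ℕ → Λ)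
    (ν ν' : ℕ → ℕ) : Prop where
  left_lt : ∀ x, ν x < w.length
  right_lt : ∀ x, ν' x < w'.length
  view_eq : ∀ x < B, ∀ u : List (Bool × Bool), u.length ≤ R →
    (walk h w u (ν x)).map lab = (walk h w' u (ν' x)).map lab'
  walk_iff : ∀ x < B, ∀ y < B, ∀ u : List (Bool × Bool), u.length ≤ R →
    (walk h w u (ν x) = some (ν y) ↔ walk h w' u (ν' x) = some (ν' y))
  counts : SameCounts h R N w w' lab lab'

lemma view_eq_view_iff {r i j : ℕ} : view h w lab r i = view h w' lab' r j ↔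
    ∀ u : List (Bool × Bool), u.length ≤ r →
      (walk h w u i).map lab = (walk h w' u j).map lab' := by
  constructor
  · intro e u hu
    have := congrFun e u
    simpa only [view, if_pos hu] using this
  · intro e
    ext1 u
    unfold view
    split_ifs with hu
    · exact e u hu
    · rfl

namespace PointedSimilar

lemma symm (hs : PointedSimilar h R N B w w' lab lab' ν ν') : PointedSimilar h R N B w' w lab' lab ν' ν where
  left_lt := hs.right_lt
  right_lt := hs.left_lt
  view_eq x hx u hu := (hs.view_eq x hx u hu).symm
  walk_iff x hx y hy u hu := (hs.walk_iff x hx y hy u hu).symm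
  counts r hr t k hk := (hs.counts r hr t k hk).symm

lemma mono {R' N' B' : ℕ} (hs : PointedSimilar h R' N' B' w w' lab lab' ν ν') (hR : R ≤ R')
    (hN : N ≤ N') (hB : B ≤ B') : PointedSimilar h R N B w w' lab lab' ν ν' where
  left_lt := hs.left_lt
  right_lt := hs.right_lt
  view_eq x hx u hu := hs.view_eq x (hx.trans_le hB) u (hu.trans hR)
  walk_iff x hx y hy u hu :=
    hs.walk_iff x (hx.trans_le hB) y (hy.trans_le hB) u (hu.trans hR)
  counts r hr t k hk := hs.counts r (hr.trans hR) t k (hk.trans hN)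

lemma lab_eq (hs : PointedSimilar h R N B w w' lab lab' ν ν') {x : ℕ} (hx : x < B) :
    lab (ν x) = lab' (ν' x) := by
  simpa [walk] using hs.view_eq x hx [] (Nat.zero_le _)

lemma arrow_iff (hs : PointedSimilar h R N B w w' lab lab' ν ν') (hR : 1 ≤ R) {x y : ℕ} (hx : x < B)
    (hy : y < B) (d : Bool × Bool) : Arrow h w d (ν x) (ν y) ↔ Arrow h w' d (ν' x) (ν' y) := by
  simpa [walk, move_eq_some] using hs.walk_iff x hx y hy [d] hR

end PointedSimilar

lemma walk_self_iff (hsep : Separated h w R lab) {u : List (Bool × Bool)} (hu : u.length ≤ R)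
    {i : ℕ} : walk h w u i = some i ↔ (walk h w u i).map lab = some (lab i) := by
  constructor
  · intro e
    rw [e, Option.map_some]
  · intro e
    obtain ⟨j, hj, hlab⟩ := Option.map_eq_some_iff.1 e
    rw [hj, hsep u i j hu hj hlab.symm]

/-- Extending the invariant to one more position, given its relation to the old ones. -/
lemma PointedSimilar.update {x i i' : ℕ} (hs : PointedSimilar h R N B w w' lab lab' ν ν')
    (hsep : Separated h w R lab) (hsep' : Separated h w' R lab') (hi : i < w.length)
    (hi' : i' < w'.length)
    (hv : ∀ u : List (Bool × Bool), u.length ≤ R →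
      (walk h w u i).map lab = (walk h w' u i').map lab')
    (hw : ∀ y < B, ∀ u : List (Bool × Bool), u.length ≤ R →
      (walk h w u i = some (ν y) ↔ walk h w' u i' = some (ν' y))) :
    PointedSimilar h R N B w w' lab lab' (Function.update ν x i) (Function.update ν' x i') where
  left_lt y := by
    rcases eq_or_ne y x with rfl | hy
    · rwa [Function.update_self]
    · rw [Function.update_of_ne hy]; exact hs.left_lt y
  right_lt y := by
    rcases eq_or_ne y x with rfl | hy
    · rwa [Function.update_self]
    · rw [Function.update_of_ne hy]; exact hs.right_lt y
  view_eq y hy u hu := by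
    rcases eq_or_ne y x with rfl | hyx
    · simpa only [Function.update_self] using hv u hu
    · simpa only [Function.update_of_ne hyx] using hs.view_eq y hy u hu
  walk_iff y hy z hz u hu := by
    have hlab : lab i = lab' i' := by simpa [walk] using hv [] (Nat.zero_le _)
    rcases eq_or_ne y x with rfl | hyx <;> rcases eq_or_ne z y with rfl | hzy
    · simp only [Function.update_self]
      rw [walk_self_iff hsep hu, walk_self_iff hsep' hu, hv u hu, hlab]
    · simp only [Function.update_self, Function.update_of_ne hzy]
      exact hw z hz u hu
    · simp only [Function.update_of_ne hyx]
      exact hs.walk_iff z hy z hy u hu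
    · rcases eq_or_ne z x with rfl | hzx
      · simp only [Function.update_self, Function.update_of_ne hyx]
        have hiff := hw y hy (revWalk u) (by simpa using hu)
        constructor
        · intro e
          have := walk_revWalk (hiff.1 (walk_revWalk e))
          rwa [revWalk_revWalk] at this
        · intro e
          have := walk_revWalk (hiff.2 (walk_revWalk e))
          rwa [revWalk_revWalk] at this
      · simp only [Function.update_of_ne hyx, Function.update_of_ne hzx]
        exact hs.walk_iff y hy z hz u hu
  counts := hs.counts

/-- Positions near the chosen ones with a prescribed view. -/
def nearWithView (h : CRAlphabet K A) (w : List A) (lab : ℕ → Λ) (ν : ℕ → ℕ) (R B : ℕ)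
    (t : List (Bool × Bool) → Option Λ) : Set ℕ :=
  {j | (j < w.length ∧ view h w lab R j = t) ∧
    ∃ y < B, ∃ u : List (Bool × Bool), u.length ≤ R ∧ walk h w u (ν y) = some j}

lemma finite_view_set (r : ℕ) (t : List (Bool × Bool) → Option Λ) :
    {i | i < w.length ∧ view h w lab r i = t}.Finite :=
  (Set.finite_lt_nat w.length).subset fun _ hi => hi.1

lemma finite_nearWithView (t : List (Bool × Bool) → Option Λ) :
    (nearWithView h w lab ν R B t).Finite :=
  (finite_view_set R t).subset fun _ hi => hi.1

lemma ncard_nearWithView_le (t : List (Bool × Bool) → Option Λ) :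
    (nearWithView h w lab ν R B t).ncard ≤
      B * Nat.card {u : List (Bool × Bool) // u.length ≤ R} := by
  have hsub : nearWithView h w lab ν R B t ⊆
      (fun p : Fin B × {u : List (Bool × Bool) // u.length ≤ R} =>
        (walk h w p.2.1 (ν p.1)).getD 0) '' Set.univ := by
    rintro j ⟨-, y, hy, u, hu, hj⟩
    exact ⟨(⟨y, hy⟩, ⟨u, hu⟩), trivial, by simp [hj]⟩
  refine (Set.ncard_le_ncard hsub (Set.toFinite _)).trans ((Set.ncard_image_le).trans ?_)
  rw [Set.ncard_univ, Nat.card_prod, Nat.card_fin]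

/-- A walk from a chosen position can be copied in the similar structure. -/
lemma PointedSimilar.exists_copy (hs : PointedSimilar h (2 * R) N B w w' lab lab' ν ν') {y j : ℕ} (hy : y < B)
    {p : List (Bool × Bool)} (hp : p.length ≤ R) (hj : walk h w p (ν y) = some j) :
    ∃ j', walk h w' p (ν' y) = some j' ∧ ∀ u : List (Bool × Bool), u.length ≤ R →
      (walk h w u j).map lab = (walk h w' u j').map lab' := by
  have h1 := hs.view_eq y hy p (by omega)
  rw [hj, Option.map_some, eq_comm, Option.map_eq_some_iff] at h1
  obtain ⟨j', hj', -⟩ := h1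
  refine ⟨j', hj', fun u hu => ?_⟩
  simpa [walk_append, hj, hj'] using hs.view_eq y hy (p ++ u) (by simp; omega)

lemma PointedSimilar.ncard_nearWithView_le (hs : PointedSimilar h (2 * R) N B w w' lab lab' ν ν')
    (t : List (Bool × Bool) → Option Λ) :
    (nearWithView h w lab ν R B t).ncard ≤ (nearWithView h w' lab' ν' R B t).ncard := by
  have hex : ∀ j ∈ nearWithView h w lab ν R B t, ∃ j' ∈ nearWithView h w' lab' ν' R B t,
      ∃ y < B, ∃ p : List (Bool × Bool), p.length ≤ R ∧ walk h w p (ν y) = some j ∧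
        walk h w' p (ν' y) = some j' := by
    rintro j ⟨⟨hj, rfl⟩, y, hy, p, hp, hpj⟩
    obtain ⟨j', hj', hv⟩ := hs.exists_copy hy hp hpj
    exact ⟨j', ⟨⟨lt_length_of_walk (hs.right_lt y) hj', (view_eq_view_iff.2 hv).symm⟩,
      y, hy, p, hp, hj'⟩, y, hy, p, hp, hpj, hj'⟩
  choose! f hf y hy p hp hpj hpf using hex
  refine Set.ncard_le_ncard_of_injOn f hf (fun j hj k hk e => ?_) (finite_nearWithView t)
  have h1 : walk h w' (p j ++ revWalk (p k)) (ν' (y j)) = some (ν' (y k)) := by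
    rw [walk_append, hpf j hj, Option.bind_some, e]
    exact walk_revWalk (hpf k hk)
  have h2 := (hs.walk_iff _ (hy j hj) _ (hy k hk) _ (by
    have := hp j hj
    have := hp k hk
    simp; omega)).2 h1
  rw [walk_append, hpj j hj, Option.bind_some] at h2
  have h3 := walk_revWalk h2
  rw [revWalk_revWalk, hpj k hk] at h3
  exact (Option.some_inj.1 h3).symm

/-- The back-and-forth property. -/
lemma PointedSimilar.exists_update
    (hs : PointedSimilar h (2 * R) (max N (B * Nat.card {u : List (Bool × Bool) // u.length ≤ R} + 1)) B
      w w' lab lab' ν ν')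
    (hsep : Separated h w R lab) (hsep' : Separated h w' R lab') (x : ℕ) {i : ℕ}
    (hi : i < w.length) :
    ∃ i' < w'.length, PointedSimilar h R N B w w' lab lab' (Function.update ν x i)
      (Function.update ν' x i') := by
  have hs' : PointedSimilar h R N B w w' lab lab' ν ν' :=
    hs.mono (by omega) (le_max_left _ _) le_rfl
  by_cases hnear : ∃ y < B, ∃ p : List (Bool × Bool), p.length ≤ R ∧ walk h w p (ν y) = some i
  · obtain ⟨y, hy, p, hp, hpi⟩ := hnear
    obtain ⟨i', hi', hv⟩ := hs.exists_copy hy hp hpi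
    have hlt := lt_length_of_walk (hs.right_lt y) hi'
    refine ⟨i', hlt, hs'.update hsep hsep' hi hlt hv fun z hz u hu => ?_⟩
    simpa [walk_append, hpi, hi'] using hs.walk_iff y hy z hz (p ++ u) (by simp; omega)
  · set t := view h w lab R i with ht
    have h1 : (nearWithView h w lab ν R B t).ncard + 1 ≤ viewCount h w lab R t := by
      refine Set.ncard_lt_ncard ⟨fun j hj => hj.1, fun hsub => ?_⟩ (finite_view_set R t)
      exact hnear (hsub (a := i) ⟨hi, rfl⟩).2
    have h2 := (hs.counts R (by omega) t _ (by
      have := _root_.ncard_nearWithView_le (h := h) (w := w) (lab := lab) (ν := ν) (R := R)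
        (B := B) t
      exact (Nat.succ_le_succ this).trans (le_max_right _ _))).1 h1
    have h3 := hs.symm.ncard_nearWithView_le t
    obtain ⟨i', hi', hni'⟩ := Set.exists_mem_notMem_of_ncard_lt_ncard
      (show (nearWithView h w' lab' ν' R B t).ncard <
        {i | i < w'.length ∧ view h w' lab' R i = t}.ncard from lt_of_lt_of_le
          (Nat.lt_succ_of_le h3) h2) (finite_nearWithView t)
    have hnear' : ¬ ∃ y < B, ∃ p : List (Bool × Bool), p.length ≤ R ∧
        walk h w' p (ν' y) = some i' := fun hex => hni' ⟨hi', hex⟩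
    refine ⟨i', hi'.1, hs'.update hsep hsep' hi hi'.1
      (view_eq_view_iff.1 hi'.2.symm) fun z hz u hu => ?_⟩
    refine iff_of_false (fun e => hnear ?_) (fun e => hnear' ?_)
    · exact ⟨z, hz, revWalk u, by simpa using hu, walk_revWalk e⟩
    · exact ⟨z, hz, revWalk u, by simpa using hu, walk_revWalk e⟩

lemma Separated.mono {R' : ℕ} (hsep : Separated h w R' lab) (hR : R ≤ R') : Separated h w R lab :=
  fun u i j hu => hsep u i j (hu.trans hR)

/-- Valuations with similar pointed views satisfy the same first-order formulas. -/
theorem exists_similar_imp_sat_iff (h : CRAlphabet K A) {φ : MSO A}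
    (hφ : FirstOrder φ) : ∃ R N B, ∀ (Λ : Type) (w w' : List A) (lab lab' : ℕ → Λ) (ν ν' : ℕ → ℕ)
      (μv μv' : ℕ → Set ℕ), Separated h w R lab → Separated h w' R lab' →
      LabelsDetermine w w' lab lab' μv μv' → PointedSimilar h R N B w w' lab lab' ν ν' →
      (Sat h w φ ν μv ↔ Sat h w' φ ν' μv') := by
  induction φ with
  | lab a x =>
    refine ⟨0, 0, x + 1, fun Λ w w' lab lab' ν ν' μv μv' _ _ hdet hs => ?_⟩
    simp only [Sat, (hdet _ (hs.left_lt x) _ (hs.right_lt x) (hs.lab_eq (Nat.lt_succ_self x))).1]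
  | succ x y =>
    refine ⟨1, 0, max x y + 1, fun Λ w w' lab lab' ν ν' μv μv' _ _ hdet hs => ?_⟩
    exact hs.arrow_iff le_rfl (x := x) (y := y) (by omega) (by omega) (false, true)
  | mu x y =>
    refine ⟨1, 0, max x y + 1, fun Λ w w' lab lab' ν ν' μv μv' _ _ hdet hs => ?_⟩
    exact hs.arrow_iff le_rfl (x := x) (y := y) (by omega) (by omega) (true, true)
  | eq x y =>
    refine ⟨0, 0, max x y + 1, fun Λ w w' lab lab' ν ν' μv μv' _ _ hdet hs => ?_⟩
    simpa [walk, Sat] using hs.walk_iff x (by omega) y (by omega) [] le_rfl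
  | mem x X =>
    refine ⟨0, 0, x + 1, fun Λ w w' lab lab' ν ν' μv μv' _ _ hdet hs => ?_⟩
    exact (hdet _ (hs.left_lt x) _ (hs.right_lt x) (hs.lab_eq (Nat.lt_succ_self x))).2 X
  | not φ ih =>
    obtain ⟨R, N, B, hRNB⟩ := ih hφ
    exact ⟨R, N, B, fun Λ w w' lab lab' ν ν' μv μv' h1 h2 h3 h4 =>
      not_congr (hRNB Λ w w' lab lab' ν ν' μv μv' h1 h2 h3 h4)⟩
  | or φ ψ ih ih' =>
    obtain ⟨R, N, B, hsat⟩ := ih hφ.1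
    obtain ⟨R', N', B', hsat'⟩ := ih' hφ.2
    refine ⟨max R R', max N N', max B B', fun Λ w w' lab lab' ν ν' μv μv' h1 h2 h3 h4 => ?_⟩
    exact or_congr
      (hsat Λ w w' lab lab' ν ν' μv μv' (h1.mono (by omega)) (h2.mono (by omega)) h3
        (h4.mono (by omega) (by omega) (by omega)))
      (hsat' Λ w w' lab lab' ν ν' μv μv' (h1.mono (by omega)) (h2.mono (by omega)) h3
        (h4.mono (by omega) (by omega) (by omega)))
  | ex1 x φ ih =>
    obtain ⟨R, N, B, hRNB⟩ := ih hφ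
    refine ⟨2 * R, max N (B * Nat.card {u : List (Bool × Bool) // u.length ≤ R} + 1), B,
      fun Λ w w' lab lab' ν ν' μv μv' h1 h2 h3 h4 => ?_⟩
    have h1 := h1.mono (show R ≤ 2 * R by omega)
    have h2 := h2.mono (show R ≤ 2 * R by omega)
    constructor
    · rintro ⟨i, hi, hsat⟩
      obtain ⟨i', hi', hs⟩ := h4.exists_update h1 h2 x hi
      exact ⟨i', hi', (hRNB _ _ _ _ _ _ _ _ _ h1 h2 h3 hs).1 hsat⟩
    · rintro ⟨i', hi', hsat⟩
      obtain ⟨i, hi, hs⟩ := h4.symm.exists_update h2 h1 x hi'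
      exact ⟨i, hi, (hRNB _ _ _ _ _ _ _ _ _ h1 h2 h3 hs.symm).2 hsat⟩
  | ex2 X φ => exact hφ.elim

/-- Hanf's theorem: counting views up to a threshold determines first-order sentences. -/
theorem exists_sameCounts_imp_sat_iff (h : CRAlphabet K A) {φ : MSO A}
    (hφ : FirstOrder φ) : ∃ R N, ∀ (Λ : Type) (w w' : List A) (lab lab' : ℕ → Λ)
      (μv μv' : ℕ → Set ℕ),
      w ≠ [] → w' ≠ [] → Separated h w R lab → Separated h w' R lab' →
      LabelsDetermine w w' lab lab' μv μv' → SameCounts h R N w w' lab lab' →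
      (Sat h w φ (fun _ => 0) μv ↔ Sat h w' φ (fun _ => 0) μv') := by
  obtain ⟨R, N, B, hRNB⟩ := exists_similar_imp_sat_iff h hφ
  refine ⟨R + 1, N + 1, fun Λ w w' lab lab' μv μv' hw hw' h1 h2 h3 h4 => ?_⟩
  have hlen := List.length_pos_of_ne_nil hw
  have hlen' := List.length_pos_of_ne_nil hw'
  have hview : ∀ u : List (Bool × Bool), u.length ≤ R + 1 →
      (walk h w u 0).map lab = (walk h w' u 0).map lab' := by
    have hc : 1 ≤ viewCount h w lab (R + 1) (view h w lab (R + 1) 0) :=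
      (Set.ncard_pos (finite_view_set _ _)).2 ⟨0, hlen, rfl⟩
    obtain ⟨i, hi, hv⟩ := (Set.ncard_pos (finite_view_set _ _)).1
      ((h4 (R + 1) le_rfl _ 1 (by omega)).1 hc)
    have hv' := view_eq_view_iff.1 hv
    obtain rfl : i = 0 := by
      by_contra hi0
      have h0 : move h w (false, false) 0 = none :=
        move_eq_none.2 fun j hj => by
          have : 0 = j + 1 := hj.1
          omega
      have hpos : move h w' (false, false) i = some (i - 1) :=
        move_eq_some.2 ⟨by omega, hi⟩
      have := hv' [(false, false)] (by simp)
      simp [walk, h0, hpos] at this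
    exact fun u hu => (hv' u hu).symm
  refine hRNB Λ w w' lab lab' _ _ μv μv' (h1.mono (by omega)) (h2.mono (by omega)) h3
    ⟨fun _ => hlen, fun _ => hlen', fun x _ u hu => hview u (by omega), fun x _ y _ u hu => ?_,
      fun r hr t k hk => h4 r (by omega) t k (by omega)⟩
  have hlab : lab 0 = lab' 0 := by simpa [walk] using hview [] (Nat.zero_le _)
  rw [walk_self_iff h1 (by omega), walk_self_iff h2 (by omega), hview u (by omega), hlab]

end Views

section LocalTiling

variable {K : ℕ} {A Λ : Type}

/-- Functions on walks that vanish on walks of length more than `ρ`. -/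
abbrev BoundedView (Λ : Type) (ρ : ℕ) : Type :=
  {v : List (Bool × Bool) → Option Λ // ∀ u : List (Bool × Bool), ρ < u.length → v u = none}

instance finite_boundedView [Finite Λ] (ρ : ℕ) : Finite (BoundedView Λ ρ) := by
  refine Finite.of_injective
    (fun v (u : {u : List (Bool × Bool) // u.length ≤ ρ}) => v.1 u.1) fun v v' e => ?_
  ext1
  funext u
  by_cases hu : u.length ≤ ρ
  · exact congrFun e ⟨u, hu⟩
  · rw [v.2 u (not_le.1 hu), v'.2 u (not_le.1 hu)]

/-- The restriction of a view to walks of length at most `r`. -/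
def truncateView (r : ℕ) (v : List (Bool × Bool) → Option Λ) (u : List (Bool × Bool)) : Option Λ :=
  if u.length ≤ r then v u else none

lemma truncateView_view {h : CRAlphabet K A} {w : List A} {lab : ℕ → Λ} {r ρ i : ℕ}
    (hr : r ≤ ρ) : truncateView r (view h w lab ρ i) = view h w lab r i := by
  funext u
  unfold truncateView view
  split_ifs <;> first | rfl | omega

/-- Numbers of occurrences of views of radius at most `R`, up to the threshold `N`. -/
abbrev ViewProfile (Λ : Type) (R N : ℕ) : Type :=
  Fin (R + 1) × BoundedView Λ (R + 1) → Fin (N + 1)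

open Classical in
/-- The profile of the first `n` terms of a sequence of views. -/
noncomputable def viewProfile (R N : ℕ) (v : ℕ → List (Bool × Bool) → Option Λ) (n : ℕ) :
    ViewProfile Λ R N := fun p =>
  ⟨min N (Nat.count (fun i => truncateView p.1 (v i) = p.2.1) n), by omega⟩

open Classical in
/-- The profile obtained by counting one more view. -/
noncomputable def ViewProfile.step {R N : ℕ} (P : ViewProfile Λ R N)
    (v : List (Bool × Bool) → Option Λ) : ViewProfile Λ R N := fun p =>
  ⟨min N ((P p : ℕ) + if truncateView p.1 v = p.2.1 then 1 else 0), by omega⟩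

lemma viewProfile_succ {R N : ℕ} (v : ℕ → List (Bool × Bool) → Option Λ) (n : ℕ) :
    viewProfile R N v (n + 1) = (viewProfile R N v n).step (v n) := by
  funext p
  ext1
  simp only [viewProfile, ViewProfile.step, Nat.count_succ]
  split_ifs <;> omega

lemma viewProfile_zero {R N : ℕ} (v : ℕ → List (Bool × Bool) → Option Λ) :
    viewProfile R N v 0 = fun _ => 0 := by
  funext p
  ext1
  simp [viewProfile]

lemma viewProfile_congr {R N n : ℕ} {v v' : ℕ → List (Bool × Bool) → Option Λ}
    (hv : ∀ i < n, v i = v' i) : viewProfile R N v n = viewProfile R N v' n := by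
  induction n with
  | zero => rw [viewProfile_zero, viewProfile_zero]
  | succ n ih =>
    rw [viewProfile_succ, viewProfile_succ, ih fun i hi => hv i (by omega), hv n (by omega)]

lemma viewProfile_view {h : CRAlphabet K A} {w : List A} {lab : ℕ → Λ} {R N r : ℕ} (hr : r ≤ R)
    (t : BoundedView Λ (R + 1)) :
    (viewProfile R N (view h w lab (R + 1)) w.length (⟨r, by omega⟩, t) : ℕ) =
      min N (viewCount h w lab r t.1) := by
  classical
  simp only [viewProfile, viewCount, Nat.count_eq_card_filter_range]
  rw [← Set.ncard_coe_finset]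
  congr 2
  ext i
  simp [truncateView_view (show r ≤ R + 1 by omega)]

lemma viewCount_eq_zero {h : CRAlphabet K A} {w : List A} {lab : ℕ → Λ} {r : ℕ}
    {t : List (Bool × Bool) → Option Λ}
    (ht : ¬ ∀ u : List (Bool × Bool), r < u.length → t u = none) : viewCount h w lab r t = 0 := by
  rw [viewCount, Set.ncard_eq_zero (finite_view_set r t), Set.eq_empty_iff_forall_notMem]
  rintro i ⟨-, rfl⟩
  exact ht fun u hu => if_neg (not_le.2 hu)

lemma sameCounts_of_viewProfile_eq {h : CRAlphabet K A} {w w' : List A} {lab lab' : ℕ → Λ}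
    {R N : ℕ} (he : viewProfile R N (view h w lab (R + 1)) w.length =
      viewProfile R N (view h w' lab' (R + 1)) w'.length) : SameCounts h R N w w' lab lab' := by
  intro r hr t k hk
  by_cases ht : ∀ u : List (Bool × Bool), r < u.length → t u = none
  · let t' : BoundedView Λ (R + 1) := ⟨t, fun u hu => ht u (by omega)⟩
    have h1 := viewProfile_view (h := h) (w := w) (lab := lab) (N := N) hr t'
    have h2 := viewProfile_view (h := h) (w := w') (lab := lab') (N := N) hr t'
    rw [he, h2] at h1
    simp only [t'] at h1
    omega
  · rw [viewCount_eq_zero ht, viewCount_eq_zero ht]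

/-- The tiling system that guesses the views of radius `R + 1`, checks them locally, and counts
them up to the threshold `N`. -/
noncomputable def viewTiling (ℓ : Λ → A) (R N : ℕ) (acc : ViewProfile Λ R N → Prop) :
    TilingSystem A (BoundedView Λ (R + 1) × ViewProfile Λ R N) where
  letter a c := (c.1.1 []).map ℓ = some a ∧ ∀ u : List (Bool × Bool), u.length ≤ R →
    c.1.1 u = c.1.1 [] → ∀ d, c.1.1 (u ++ [d]) = c.1.1 [d]
  init c := (∀ u, c.1.1 ((false, false) :: u) = none) ∧
    c.2 = ViewProfile.step (fun _ => 0) c.1.1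
  final c := (∀ u, c.1.1 ((false, true) :: u) = none) ∧ acc c.2
  next c c' := (∀ u : List (Bool × Bool), u.length ≤ R →
    c.1.1 ((false, true) :: u) = c'.1.1 u ∧ c'.1.1 ((false, false) :: u) = c.1.1 u) ∧
      c'.2 = c.2.step c'.1.1
  nest c c' := ∀ u : List (Bool × Bool), u.length ≤ R →
    c.1.1 ((true, true) :: u) = c'.1.1 u ∧ c'.1.1 ((true, false) :: u) = c.1.1 u
  noRet c := ∀ u, c.1.1 ((true, true) :: u) = none
  noCall c := ∀ u, c.1.1 ((true, false) :: u) = none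

section

variable {h : CRAlphabet K A} {w : List A} {ℓ : Λ → A} {R N : ℕ}
  {acc : ViewProfile Λ R N → Prop} {c : ℕ → BoundedView Λ (R + 1) × ViewProfile Λ R N}

lemma cons_eq_of_arrow (hc : (viewTiling ℓ R N acc).Valid h w c) {d : Bool × Bool} {i j : ℕ}
    (hd : Arrow h w d i j) {u : List (Bool × Bool)} (hu : u.length ≤ R) :
    (c i).1.1 (d :: u) = (c j).1.1 u := by
  obtain ⟨_ | _, _ | _⟩ := d
  · obtain ⟨rfl, hlt⟩ := hd
    exact ((hc.next _ hlt).1 u hu).2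
  · obtain ⟨rfl, hlt⟩ := hd
    exact ((hc.next _ hlt).1 u hu).1
  · exact (hc.nest _ _ hd u hu).2
  · exact (hc.nest _ _ hd u hu).1

lemma cons_eq_none_of_move (hc : (viewTiling ℓ R N acc).Valid h w c) {d : Bool × Bool} {i : ℕ}
    (hi : i < w.length) (hd : move h w d i = none) (u : List (Bool × Bool)) :
    (c i).1.1 (d :: u) = none := by
  rw [move_eq_none] at hd
  obtain ⟨_ | _, _ | _⟩ := d
  · cases i with
    | zero => exact (hc.init hi).1 u
    | succ i => exact absurd ⟨rfl, hi⟩ (hd i)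
  · by_cases hlt : i + 1 < w.length
    · exact absurd ⟨rfl, hlt⟩ (hd (i + 1))
    · exact (hc.final i (by omega)).1 u
  · exact hc.noCall i hi hd u
  · exact hc.noRet i hi hd u

lemma exists_lab_of_valid (hw : w ≠ []) (hc : (viewTiling ℓ R N acc).Valid h w c) :
    ∃ lab : ℕ → Λ, (∀ i < w.length, w[i]? = some (ℓ (lab i))) ∧
      (∀ i < w.length, (c i).1.1 = view h w lab (R + 1) i) := by
  have hex : ∀ i < w.length, ∃ b, (c i).1.1 [] = some b ∧ w[i]? = some (ℓ b) := by
    intro i hi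
    have hwi := List.getElem?_eq_getElem hi
    obtain ⟨b, hb, hℓ⟩ := Option.map_eq_some_iff.1 (hc.letter i _ hwi).1
    exact ⟨b, hb, by rw [hwi, hℓ]⟩
  have : Nonempty Λ := ⟨(hex 0 (List.length_pos_of_ne_nil hw)).choose⟩
  choose! lab hlab hℓ using hex
  refine ⟨lab, hℓ, fun i hi => ?_⟩
  have key : ∀ u : List (Bool × Bool), ∀ i < w.length, u.length ≤ R + 1 →
      (c i).1.1 u = (walk h w u i).map lab := by
    intro u
    induction u with
    | nil => exact fun i hi _ => hlab i hi
    | cons d u ih =>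
      intro i hi hu
      rw [List.length_cons] at hu
      rcases hm : move h w d i with _ | j
      · rw [cons_eq_none_of_move hc hi hm, walk, hm]
        rfl
      · have ha := move_eq_some.1 hm
        rw [cons_eq_of_arrow hc ha (by omega), ih j ha.lt_length.2 (by omega), walk, hm,
          Option.bind_some]
  funext u
  unfold view
  split_ifs with hu
  · exact key u i hi hu
  · exact (c i).1.2 u (not_le.1 hu)

lemma viewProfile_of_valid (hc : (viewTiling ℓ R N acc).Valid h w c) {i : ℕ} (hi : i < w.length) :
    (c i).2 = viewProfile R N (fun i => (c i).1.1) (i + 1) := by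
  induction i with
  | zero => rw [viewProfile_succ, viewProfile_zero]; exact (hc.init hi).2
  | succ i ih => rw [viewProfile_succ, ← ih (by omega)]; exact (hc.next i hi).2

lemma valid_view {lab : ℕ → Λ} (hℓ : ∀ i < w.length, w[i]? = some (ℓ (lab i)))
    (hsep : Separated h w R lab)
    (hacc : acc (viewProfile R N (view h w lab (R + 1)) w.length)) :
    (viewTiling ℓ R N acc).Valid h w fun i =>
      (⟨view h w lab (R + 1) i, fun _ hu => if_neg (not_le.2 hu)⟩,
        viewProfile R N (view h w lab (R + 1)) (i + 1)) := by
  have hview : ∀ (i : ℕ) (u : List (Bool × Bool)), u.length ≤ R + 1 →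
      view h w lab (R + 1) i u = (walk h w u i).map lab := fun i u hu => if_pos hu
  have hcons : ∀ (d : Bool × Bool) (u : List (Bool × Bool)) (i j : ℕ), u.length ≤ R →
      Arrow h w d i j → view h w lab (R + 1) i (d :: u) = view h w lab (R + 1) j u := by
    intro d u i j hu ha
    rw [hview _ _ (by simpa using hu), hview _ _ (by omega), walk, move_eq_some.2 ha,
      Option.bind_some]
  have hnone : ∀ (d : Bool × Bool) (u : List (Bool × Bool)) (i : ℕ),
      (∀ j, ¬ Arrow h w d i j) → view h w lab (R + 1) i (d :: u) = none := by
    intro d u i hd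
    unfold view
    rw [walk, move_eq_none.2 hd]
    simp
  refine ⟨fun i a ha => ⟨?_, fun u hu he d => ?_⟩, fun _ => ⟨fun u => ?_, ?_⟩,
    fun i hi => ⟨fun u => ?_, ?_⟩, fun i hi => ⟨fun u hu => ⟨?_, ?_⟩, ?_⟩,
    fun i j hij u hu => ⟨?_, ?_⟩, fun i hi hno u => ?_, fun i hi hno u => ?_⟩
  · have := hℓ i (List.getElem?_eq_some_iff.1 ha).1
    rw [ha] at this
    change (view h w lab (R + 1) i []).map ℓ = some a
    rw [hview _ _ (by simp), this]
    rfl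
  · change view h w lab (R + 1) i u = view h w lab (R + 1) i [] at he
    change view h w lab (R + 1) i (u ++ [d]) = view h w lab (R + 1) i [d]
    rw [hview _ _ (by omega), hview _ [] (by simp)] at he
    obtain ⟨j, hj, hlab⟩ := Option.map_eq_some_iff.1 he
    obtain rfl := hsep u i j hu hj hlab.symm
    rw [hview _ _ (by simpa using hu), hview _ _ (by simp), walk_append, hj, Option.bind_some]
  · exact hnone _ _ _ fun j hj => by have : 0 = j + 1 := hj.1; omega
  · rw [viewProfile_succ, viewProfile_zero]
  · exact hnone _ _ _ fun j hj => by
      have h1 : j = i + 1 := hj.1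
      have h2 : j < w.length := hj.2
      omega
  · rwa [hi]
  · exact hcons _ _ _ _ hu ⟨rfl, hi⟩
  · exact hcons _ _ _ _ hu ⟨rfl, hi⟩
  · rw [viewProfile_succ]
  · exact hcons _ _ _ _ hu hij
  · exact hcons _ _ _ _ hu hij
  · exact hnone _ _ _ hno
  · exact hnone _ _ _ hno

end

/-- A property of separated labellings that depends only on thresholded numbers of views is
recognized by a tiling system. -/
theorem exists_tiling_of_sameCounts (h : CRAlphabet 2 A) [Finite Λ] (ℓ : Λ → A) (R N : ℕ)
    (p : List A → (ℕ → Λ) → Prop)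
    (hp : ∀ w w' lab lab', w ≠ [] → w' ≠ [] → (∀ i < w.length, w[i]? = some (ℓ (lab i))) →
      (∀ i < w'.length, w'[i]? = some (ℓ (lab' i))) → Separated h w R lab →
      Separated h w' R lab' → SameCounts h R N w w' lab lab' → p w lab → p w' lab') :
    ∃ (C : Type) (_ : Finite C) (T : TilingSystem A C), ∀ w ≠ [], (∃ c, T.Valid h w c) ↔
      ∃ lab, (∀ i < w.length, w[i]? = some (ℓ (lab i))) ∧ Separated h w R lab ∧ p w lab := by
  refine ⟨_, inferInstance, viewTiling ℓ R N fun P => ∃ w lab, w ≠ [] ∧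
    (∀ i < w.length, w[i]? = some (ℓ (lab i))) ∧ Separated h w R lab ∧ p w lab ∧
    viewProfile R N (view h w lab (R + 1)) w.length = P, fun w hw => ⟨?_, ?_⟩⟩
  · rintro ⟨c, hc⟩
    obtain ⟨lab, hℓ, hview⟩ := exists_lab_of_valid hw hc
    have hlen := List.length_pos_of_ne_nil hw
    have hv : ∀ i < w.length, ∀ u : List (Bool × Bool), u.length ≤ R + 1 →
        (c i).1.1 u = (walk h w u i).map lab := fun i hi u hu => by
      rw [hview i hi]; exact if_pos hu
    have hsep : Separated h w R lab := by
      refine separated_of_local (fun i hi j hj e => by rw [hℓ i hi, hℓ j hj, e]) ?_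
      intro u x y hu hxy he d
      rcases u with _ | ⟨e, u⟩
      · rw [Option.some_inj.1 hxy]
      have hx : x < w.length := by
        obtain ⟨k, hk, -⟩ := walk_cons_eq_some.1 hxy
        exact hk.lt_length.1
      have h1 := (hc.letter x _ (hℓ x hx)).2 (e :: u) hu (by
        rw [hv x hx _ (by omega), hv x hx _ (by simp), hxy, Option.map_some, ← he]; rfl) d
      rw [hv x hx _ (by simpa using hu), hv x hx _ (by simp), walk_append, hxy,
        Option.bind_some] at h1
      simpa [walk] using h1.symm
    refine ⟨lab, hℓ, hsep, ?_⟩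
    obtain ⟨w', lab', hw', hℓ', hsep', hp', hP⟩ := (hc.final (w.length - 1) (by omega)).2
    refine hp w' w lab' lab hw' hw hℓ' hℓ hsep' hsep (sameCounts_of_viewProfile_eq ?_) hp'
    rw [hP, viewProfile_of_valid hc (by omega), Nat.sub_add_cancel hlen]
    exact viewProfile_congr hview
  · rintro ⟨lab, hℓ, hsep, hlab⟩
    exact ⟨_, valid_view hℓ hsep ⟨w, lab, hw, hℓ, hsep, hlab, rfl⟩⟩

end LocalTiling

section EMSO

variable {K : ℕ} {A : Type}

/-- Prenex form of existential formulas, with all set quantifiers evaluated at once. -/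
lemma IsEMSO.exists_firstOrder {φ : MSO A} (hφ : IsEMSO φ) : ∃ ψ : MSO A, FirstOrder ψ ∧ ∃ V : Set ℕ, V.Finite ∧
    ∀ (h : CRAlphabet K A) (w : List A) (ν : ℕ → ℕ), Sat h w φ ν (fun _ => ∅) ↔
      ∃ μv : ℕ → Set ℕ, (∀ X, μv X ⊆ {i | i < w.length}) ∧ (∀ X ∉ V, μv X = ∅) ∧
        Sat h w ψ ν μv := by
  have key : ∃ ψ : MSO A, FirstOrder ψ ∧ ∃ V : Set ℕ, V.Finite ∧
      ∀ (h : CRAlphabet K A) (w : List A) (ν : ℕ → ℕ) (μv : ℕ → Set ℕ), Sat h w φ ν μv ↔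
        ∃ μv' : ℕ → Set ℕ, (∀ X ∈ V, μv' X ⊆ {i | i < w.length}) ∧ (∀ X ∉ V, μv' X = μv X) ∧
          Sat h w ψ ν μv' := by
    induction hφ with
    | @fo φ hφ =>
      refine ⟨φ, hφ, ∅, Set.finite_empty, fun h w ν μv => ⟨fun hs => ⟨μv, by simp, by simp, hs⟩, ?_⟩⟩
      rintro ⟨μv', -, h2, h3⟩
      rwa [show μv' = μv from funext fun X => h2 X (Set.notMem_empty X)] at h3
    | @ex Y φ _ ih =>
      obtain ⟨ψ, hψ, V, hV, hsat⟩ := ih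
      refine ⟨ψ, hψ, insert Y V, hV.insert Y, fun h w ν μv => ?_⟩
      simp only [Sat, hsat]
      constructor
      · rintro ⟨S, hS, μv', h1, h2, h3⟩
        refine ⟨μv', fun X hX => ?_, fun X hX => ?_, h3⟩
        · by_cases hXV : X ∈ V
          · exact h1 X hXV
          · obtain rfl : X = Y := (Set.mem_insert_iff.1 hX).resolve_right hXV
            rw [h2 X hXV, Function.update_self]
            exact hS
        · rw [Set.mem_insert_iff, not_or] at hX
          rw [h2 X hX.2, Function.update_of_ne hX.1]
      · rintro ⟨μv', h1, h2, h3⟩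
        refine ⟨μv' Y, h1 Y (Set.mem_insert _ _), μv',
          fun X hX => h1 X (Set.mem_insert_of_mem _ hX), fun X hX => ?_, h3⟩
        rcases eq_or_ne X Y with rfl | hXY
        · rw [Function.update_self]
        · rw [Function.update_of_ne hXY]
          exact h2 X fun hmem => hmem.elim hXY hX
  obtain ⟨ψ, hψ, V, hV, hsat⟩ := key
  refine ⟨ψ, hψ, V, hV, fun h w ν => (hsat h w ν _).trans (exists_congr fun μv => ?_)⟩
  refine and_congr_left fun hμ => ⟨fun hsub X => ?_, fun hsub X _ => hsub X⟩
  by_cases hX : X ∈ V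
  · exact hsub X hX
  · rw [hμ.1 X hX]
    exact Set.empty_subset _

/-- The sets coded by a labelling, restricted to the first `n` positions. -/
def codedSets {V : Set ℕ} {Λ : Type} (b : Λ → V → Bool) (n : ℕ) (lab : ℕ → Λ) (X : ℕ) : Set ℕ :=
  {i | i < n ∧ ∃ hX : X ∈ V, b (lab i) ⟨X, hX⟩ = true}

/-- Existential sentences define tiling-recognizable sets of nonempty words. -/
theorem IsEMSO.exists_tiling [Finite A] (h : CRAlphabet 2 A) {φ : MSO A} (hφ : IsEMSO φ) :
    ∃ (C : Type) (_ : Finite C) (T : TilingSystem A C), ∀ w ≠ [], (∃ c, T.Valid h w c) ↔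
      Sat h w φ (fun _ => 0) (fun _ => ∅) := by
  obtain ⟨ψ, hψ, V, hV, hsat⟩ := hφ.exists_firstOrder (K := 2)
  obtain ⟨R, N, hRN⟩ := exists_sameCounts_imp_sat_iff h hψ
  have := hV.to_subtype
  let Λ := A × (V → Bool) × Fin (Nat.card {u : List (Bool × Bool) // u.length ≤ R} + 1)
  obtain ⟨C, hC, T, hT⟩ := exists_tiling_of_sameCounts h (Λ := Λ) Prod.fst R N
    (fun w lab => Sat h w ψ (fun _ => 0) (codedSets (fun c => c.2.1) w.length lab)) (by
      intro w w' lab lab' hw hw' hℓ hℓ' hsep hsep' hcounts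
      refine (hRN Λ w w' lab lab' _ _ hw hw' hsep hsep' (fun i hi j hj e => ?_) hcounts).1
      refine ⟨by rw [hℓ i hi, hℓ' j hj, e], fun X => ?_⟩
      simp only [codedSets, Set.mem_ofPred_eq, hi, hj, e])
  refine ⟨C, hC, T, fun w hw => (hT w hw).trans ?_⟩
  rw [hsat]
  constructor
  · rintro ⟨lab, -, -, hs⟩
    exact ⟨_, fun X i hi => hi.1, fun X hX => Set.eq_empty_of_forall_notMem
      fun i hi => hX hi.2.1, hs⟩
  · rintro ⟨μv, hsub, hempty, hs⟩
    classical
    obtain ⟨χ, hχ⟩ := exists_separated_colouring h w R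
    obtain ⟨a, -⟩ := List.exists_mem_of_ne_nil w hw
    refine ⟨fun i => (w.getD i a, fun X => decide (i ∈ μv X), χ i), fun i hi => ?_,
      fun u i j hu hij e => hχ u i j hu hij (congrArg (fun c : Λ => c.2.2) e), ?_⟩
    · simp [List.getElem?_eq_getElem hi, List.getD_eq_getElem?_getD]
    · convert hs using 1
      funext X
      ext i
      simp only [codedSets, Set.mem_ofPred_eq, decide_eq_true_eq, exists_prop]
      refine ⟨fun hi => hi.2.2, fun hi => ⟨hsub X hi, ?_, hi⟩⟩
      by_contra hX
      rw [hempty X hX] at hi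
      exact hi

end EMSO


/-- 2VPA capture EMSO: a set `L` of nested words over a 2-stack
call-return alphabet is recognized by some (finite) 2-stack visibly pushdown
automaton iff `L` is defined by some existential MSO sentence over the
signature `{λ_a | a ∈ Σ} ∪ {⋖, μ}`. -/
theorem stmt15 (A : Type) [Fintype A] (h : CRAlphabet 2 A)
    (L : Set (List A)) (hL : ∀ w ∈ L, w ≠ []) :
    (∃ (Q Γ : Type) (_ : Fintype Q) (_ : Fintype Γ) (M : MVPA 2 A Q Γ),
        vLang h M = L) ↔
    (∃ φ : MSO A, IsEMSO φ ∧ ClosedOn h φ ∧ mLang h φ = L) := by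
  constructor
  · rintro ⟨Q, Γ, _, _, M, rfl⟩
    obtain ⟨φ, hφ, hsat⟩ := (M.tiling h).exists_emso h
    refine ⟨φ, hφ, fun w ν ν' μv μv' => (hsat w ν μv).trans (hsat w ν' μv').symm, ?_⟩
    ext w
    refine and_congr_right fun hw => ?_
    rw [hsat, or_iff_right hw, MVPA.vAccepts_iff_tiling hw]
  · rintro ⟨φ, hφ, -, rfl⟩
    obtain ⟨C, _, T, hT⟩ := hφ.exists_tiling h
    refine ⟨_, _, Fintype.ofFinite _, Fintype.ofFinite _, T.automaton h, ?_⟩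
    ext w
    refine and_congr_right fun hw => ?_
    rw [TilingSystem.vAccepts_automaton_iff hw, hT w hw]
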